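/- arXiv:1810.07586 — 3 statements merged into one kernel-verified Lean document; each statement's English description precedes it below -/
import Mathlib

section
/- For every integer n ≥ 2, the number of (n-1)-tuples (τ_1, …, τ_{n-1}) of transpositions of {1, …, n} whose left-to-right product τ_1 τ_2 ⋯ τ_{n-1} equals the cycle c_n = (1, 2, …, n) is exactly n^{n-2}. -/
/-- `F` is a minimal factorization of size `n`, i.e. a factorization of the cycle
`(1,2,…,n)` (represented as `finRotate n` on `Fin n`, where the element `i ∈ {1,…,n}`
corresponds to the index `i-1 : Fin n`) into `n-1` transpositions: each `F k` is a
transposition and the left-to-right product `τ₁ τ₂ ⋯ τ_{n-1}` (apply `τ₁` first)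
equals the cycle. -/
def IsMinFact (n : ℕ) (F : Fin (n - 1) → Equiv.Perm (Fin n)) : Prop :=
  (∀ k, (F k).IsSwap) ∧ (List.ofFn F).reverse.prod = finRotate n

/-- `T(F, x)`: the number of transpositions in `F` moving the element represented by `x`. -/
def Tcount {n : ℕ} (F : Fin (n - 1) → Equiv.Perm (Fin n)) (x : Fin n) : ℕ :=
  (Finset.univ.filter fun k : Fin (n - 1) => F k x ≠ x).card

/-- `M(F, x)`: the number of indices `1 ≤ k ≤ n-1` with `τ₁⋯τ_{k-1}(x) ≠ τ₁⋯τ_k(x)`,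
i.e. the number of transpositions affecting the trajectory of `x` (left-to-right
partial products, so `τ₁⋯τ_k` is the product of the first `k` entries, applied
`τ₁` first). -/
def Mcount {n : ℕ} (F : Fin (n - 1) → Equiv.Perm (Fin n)) (x : Fin n) : ℕ :=
  (Finset.univ.filter fun k : Fin (n - 1) =>
    ((List.ofFn F).take k.val).reverse.prod x ≠
      ((List.ofFn F).take (k.val + 1)).reverse.prod x).card

open Equiv Equiv.Perm Finset

namespace MinimalFactorization

section Cycles

variable {α : Type*} [DecidableEq α] {σ : Perm α} {a b x y : α}

theorem sameCycle_mul_swap_cases (h : SameCycle (σ * swap a b) x y) :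
    SameCycle σ x y ∨
      (SameCycle σ x a ∨ SameCycle σ x b) ∧ (SameCycle σ y a ∨ SameCycle σ y b) := by
  let R : α → α → Prop := fun x y => SameCycle σ x y ∨
    (SameCycle σ x a ∨ SameCycle σ x b) ∧ (SameCycle σ y a ∨ SameCycle σ y b)
  have symm : ∀ {x y}, R x y → R y x := by
    rintro x y (h | ⟨h, h'⟩)
    · exact Or.inl h.symm
    · exact Or.inr ⟨h', h⟩
  have trans : ∀ {x y z}, R x y → R y z → R x z := by
    rintro x y z (h | ⟨h, h'⟩) (k | ⟨k, k'⟩)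
    · exact Or.inl (h.trans k)
    · exact Or.inr ⟨k.imp h.trans h.trans, k'⟩
    · exact Or.inr ⟨h, h'.imp k.symm.trans k.symm.trans⟩
    · exact Or.inr ⟨h, k'⟩
  have step : ∀ x, R x ((σ * swap a b) x) := by
    intro x
    simp only [R, Perm.mul_apply, sameCycle_apply_left, sameCycle_apply_right]
    rcases eq_or_ne x a with rfl | hxa
    · right; simp [SameCycle.rfl]
    rcases eq_or_ne x b with rfl | hxb
    · right; simp [SameCycle.rfl]
    · left; rw [swap_apply_of_ne_of_ne hxa hxb]
  have pow : ∀ (k : ℕ) x, R x (((σ * swap a b) ^ k) x) := by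
    intro k
    induction k with
    | zero => exact fun x => Or.inl SameCycle.rfl
    | succ k ih =>
      intro x
      rw [pow_succ', Perm.mul_apply]
      exact trans (ih x) (step _)
  obtain ⟨k, rfl⟩ := h
  obtain ⟨k, rfl | rfl⟩ := k.eq_nat_or_neg
  · exact pow k x
  · have := pow k (((σ * swap a b) ^ (-(k : ℤ))) x)
    rw [← zpow_natCast, ← Perm.mul_apply, ← zpow_add] at this
    simpa using symm this

theorem sameCycle_of_mul_swap (hab : SameCycle σ a b) (h : SameCycle (σ * swap a b) x y) :
    SameCycle σ x y := by
  rcases sameCycle_mul_swap_cases h with h | ⟨hx, hy⟩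
  · exact h
  · have hx' : SameCycle σ x a := hx.elim id fun h => h.trans hab.symm
    have hy' : SameCycle σ y a := hy.elim id fun h => h.trans hab.symm
    exact hx'.trans hy'.symm

variable [Finite α]

theorem sameCycle_mul_swap_self (hab : ¬ SameCycle σ a b) : SameCycle (σ * swap a b) a b := by
  by_contra hn
  have key : ∀ k : ℕ, ((σ * swap a b) ^ (k + 1)) a = (σ ^ (k + 1)) b := by
    intro k
    induction k with
    | zero => simp
    | succ k ih =>
      have hna : (σ ^ (k + 1)) b ≠ a := fun h => hab (SameCycle.symm ⟨(k + 1 : ℕ), by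
        rw [zpow_natCast, h]⟩)
      have hnb : (σ ^ (k + 1)) b ≠ b := fun h => hn ⟨(k + 1 : ℕ), by
        rw [zpow_natCast, ih, h]⟩
      rw [pow_succ', Perm.mul_apply, ih, Perm.mul_apply, swap_apply_of_ne_of_ne hna hnb,
        pow_succ' _ (k + 1), Perm.mul_apply]
  have hk := key (orderOf σ - 1)
  rw [Nat.sub_add_cancel (orderOf_pos σ), pow_orderOf_eq_one] at hk
  exact hn ⟨(orderOf σ : ℕ), by simpa using hk⟩

theorem sameCycle_mul_swap (hab : ¬ SameCycle σ a b) (h : SameCycle σ x y) :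
    SameCycle (σ * swap a b) x y := by
  have hs := sameCycle_mul_swap_self hab
  have step : ∀ x, SameCycle (σ * swap a b) x (σ x) := by
    intro x
    have hσ : σ x = (σ * swap a b) (swap a b x) := by simp
    rw [hσ, sameCycle_apply_right]
    rcases eq_or_ne x a with rfl | hxa
    · simpa using hs
    rcases eq_or_ne x b with rfl | hxb
    · simpa using hs.symm
    · rw [swap_apply_of_ne_of_ne hxa hxb]
  obtain ⟨k, rfl⟩ := h.exists_nat_pow_eq
  clear h
  induction k with
  | zero => exact SameCycle.rfl
  | succ k ih =>
    rw [pow_succ', Perm.mul_apply]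
    exact ih.trans (step _)

end Cycles

/-- `S` meets every cycle of `σ`, fixed points included. -/
def MeetsCycles {α : Type*} (σ : Perm α) (S : Finset α) : Prop :=
  ∀ x, ∃ s ∈ S, SameCycle σ x s

section Meets

variable {α : Type*} [DecidableEq α] {σ : Perm α} {S : Finset α} {a b : α}

theorem MeetsCycles.of_mul_swap (h : MeetsCycles (σ * swap a b) S) :
    MeetsCycles σ (insert b S) ∨ MeetsCycles σ (insert a S) := by
  obtain ⟨s, hs, has⟩ := h a
  have main : ∀ c d, (∀ z, SameCycle σ z a ∨ SameCycle σ z b → SameCycle σ z c ∨ SameCycle σ z d) →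
      SameCycle σ s c → MeetsCycles σ (insert d S) := by
    intro c d hcd hsc x
    obtain ⟨t, ht, hxt⟩ := h x
    rcases sameCycle_mul_swap_cases hxt with hxt | ⟨hx, -⟩
    · exact ⟨t, mem_insert_of_mem ht, hxt⟩
    · rcases hcd x hx with hx | hx
      · exact ⟨s, mem_insert_of_mem hs, hx.trans hsc.symm⟩
      · exact ⟨d, mem_insert_self _ _, hx⟩
  have hsab : SameCycle σ s a ∨ SameCycle σ s b := by
    rcases sameCycle_mul_swap_cases has with h | ⟨-, h⟩
    · exact Or.inl h.symm
    · exact h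
  rcases hsab with h | h
  · exact Or.inl (main a b (fun _ => id) h)
  · exact Or.inr (main b a (fun _ => Or.symm) h)

theorem MeetsCycles.of_mul_swap_of_sameCycle (hab : SameCycle σ a b)
    (h : MeetsCycles (σ * swap a b) S) : MeetsCycles σ S := fun x =>
  let ⟨s, hs, hxs⟩ := h x
  ⟨s, hs, sameCycle_of_mul_swap hab hxs⟩

theorem MeetsCycles.erase_mul_swap [Finite α] (hS : MeetsCycles σ S) (hab : ¬ SameCycle σ a b) :
    MeetsCycles (σ * swap a b) (S.erase b) := by
  intro x
  obtain ⟨s, hs, hxs⟩ := hS x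
  rcases eq_or_ne s b with rfl | hsb
  · obtain ⟨t, ht, hat⟩ := hS a
    refine ⟨t, mem_erase.2 ⟨?_, ht⟩, ?_⟩
    · rintro rfl
      exact hab hat
    · exact ((sameCycle_mul_swap hab hxs).trans (sameCycle_mul_swap_self hab).symm).trans
        (sameCycle_mul_swap hab hat)
  · exact ⟨s, mem_erase.2 ⟨hsb, hs⟩, sameCycle_mul_swap hab hxs⟩

theorem MeetsCycles.erase {s t : α} (hS : MeetsCycles σ S) (ht : t ∈ S) (hst : s ≠ t)
    (h : SameCycle σ s t) : MeetsCycles σ (S.erase s) := by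
  intro x
  obtain ⟨u, hu, hxu⟩ := hS x
  rcases eq_or_ne u s with rfl | hus
  · exact ⟨t, mem_erase.2 ⟨hst.symm, ht⟩, hxu.trans h⟩
  · exact ⟨u, mem_erase.2 ⟨hus, hu⟩, hxu⟩

end Meets

section Count

variable {α : Type*} [DecidableEq α] [Fintype α]

open Classical in
/-- The number of `m`-element sets that meet every cycle of `σ`. -/
noncomputable def numMeeting (m : ℕ) (σ : Perm α) : ℕ :=
  #{S : Finset α | S.card = m ∧ MeetsCycles σ S}

open Classical in
/-- The transpositions of a finite type. -/
noncomputable def swaps (α : Type*) [DecidableEq α] [Fintype α] : Finset (Perm α) :=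
  {τ | τ.IsSwap}

theorem mem_swaps {τ : Perm α} : τ ∈ swaps α ↔ τ.IsSwap := by
  simp [swaps]

open Classical in
theorem card_filter_not_sameCycle {m : ℕ} {σ : Perm α} {S : Finset α}
    (hσ : ∀ S, MeetsCycles σ S → m + 1 ≤ S.card) (hS : MeetsCycles σ S) (hc : S.card = m + 1)
    (v : α) : #{r ∈ S | ¬ SameCycle σ v r} = m := by
  obtain ⟨s, hs, hvs⟩ := hS v
  have : ({r ∈ S | ¬ SameCycle σ v r} : Finset α) = S.erase s := by
    ext r
    simp only [mem_filter, mem_erase]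
    constructor
    · rintro ⟨hr, hvr⟩
      refine ⟨?_, hr⟩
      rintro rfl
      exact hvr hvs
    · rintro ⟨hrs, hr⟩
      refine ⟨hr, fun hvr => ?_⟩
      have h := hσ _ (hS.erase hs hrs (hvr.symm.trans hvs))
      rw [card_erase_of_mem hr] at h
      omega
  rw [this, card_erase_of_mem hs, hc, Nat.add_sub_cancel]

open Classical in
theorem sum_swaps_numMeeting {m : ℕ} {σ : Perm α}
    (hσ : ∀ S, MeetsCycles σ S → m + 1 ≤ S.card) :
    ∑ τ ∈ swaps α, numMeeting m (σ * τ) = Fintype.card α * m * numMeeting (m + 1) σ := by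
  let Y : Finset (Σ _ : Finset α, Σ _ : α, α) :=
    ({S : Finset α | S.card = m + 1 ∧ MeetsCycles σ S} : Finset (Finset α)).sigma fun S =>
      (univ : Finset α).sigma fun v => {r ∈ S | ¬ SameCycle σ v r}
  let X : Finset (Σ _ : Perm α, Finset α) :=
    (swaps α).sigma fun τ => {S : Finset α | S.card = m ∧ MeetsCycles (σ * τ) S}
  have hX : #X = ∑ τ ∈ swaps α, numMeeting m (σ * τ) := by
    simp only [X, card_sigma, numMeeting]
  have hY : #Y = Fintype.card α * m * numMeeting (m + 1) σ := by
    simp only [Y, card_sigma, numMeeting]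
    rw [sum_congr rfl (g := fun _ => Fintype.card α * m), sum_const, smul_eq_mul, mul_comm]
    intro S hS
    simp only [mem_filter, mem_univ, true_and] at hS
    rw [sum_congr rfl fun v _ => card_filter_not_sameCycle hσ hS.2 hS.1 v, sum_const, smul_eq_mul,
      card_univ]
  rw [← hX, ← hY]
  symm
  refine card_bij (fun p _ => ⟨swap p.2.1 p.2.2, p.1.erase p.2.2⟩) ?_ ?_ ?_
  · rintro ⟨S, v, r⟩ h
    simp only [Y, X, mem_sigma, mem_filter, mem_univ, true_and, mem_swaps] at h ⊢
    obtain ⟨⟨hc, hS⟩, hr, hvr⟩ := h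
    refine ⟨⟨v, r, ?_, rfl⟩, ?_, hS.erase_mul_swap hvr⟩
    · rintro rfl
      exact hvr SameCycle.rfl
    · rw [card_erase_of_mem hr, hc, Nat.add_sub_cancel]
  · rintro ⟨S, v, r⟩ h ⟨S', v', r'⟩ h' heq
    simp only [Y, mem_sigma, mem_filter, mem_univ, true_and] at h h'
    obtain ⟨⟨hc, hS⟩, hr, hvr⟩ := h
    obtain ⟨⟨hc', hS'⟩, hr', hvr'⟩ := h'
    simp only [Sigma.mk.injEq, heq_eq_eq] at heq
    obtain ⟨hsw, her⟩ := heq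
    have hne : v ≠ r := by rintro rfl; exact hvr SameCycle.rfl
    have hcases : (v = v' ∧ r = r') ∨ (v = r' ∧ r = v') := by
      have h1 := congrArg (· v) hsw
      have h2 := congrArg (· r) hsw
      simp only [swap_apply_left, swap_apply_right, swap_apply_def] at h1 h2
      grind
    rcases hcases with ⟨rfl, rfl⟩ | ⟨rfl, rfl⟩
    · have : S = S' := by rw [← insert_erase hr, her, insert_erase hr']
      rw [this]
    · exfalso
      obtain ⟨s, hs, hvs⟩ := hS v
      have hsr : s ≠ r := by rintro rfl; exact hvr hvs
      have hs' : s ∈ S'.erase v := her ▸ mem_erase.2 ⟨hsr, hs⟩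
      rw [mem_erase] at hs'
      have h := hσ _ (hS'.erase hr' hs'.1 hvs.symm)
      rw [card_erase_of_mem hs'.2] at h
      omega
  · rintro ⟨τ, S⟩ h
    simp only [X, mem_sigma, mem_filter, mem_univ, true_and, mem_swaps] at h
    obtain ⟨⟨a, b, hab, rfl⟩, hc, hS⟩ := h
    have hnS : ¬ MeetsCycles σ S := fun h => by
      have := hσ _ h
      omega
    have hnab : ¬ SameCycle σ a b := fun h => hnS (hS.of_mul_swap_of_sameCycle h)
    have main : ∀ c d, ¬ SameCycle σ c d → MeetsCycles σ (insert d S) → ∃ p, ∃ _ : p ∈ Y,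
        (⟨swap p.2.1 p.2.2, p.1.erase p.2.2⟩ : Σ _ : Perm α, Finset α) = ⟨swap c d, S⟩ := by
      intro c d hcd hM
      have hd : d ∉ S := fun h => hnS (by rwa [insert_eq_of_mem h] at hM)
      refine ⟨⟨insert d S, c, d⟩, ?_, ?_⟩
      · simp [Y, card_insert_of_notMem hd, hc, hM, hcd]
      · simp [erase_insert hd]
    rcases hS.of_mul_swap with h | h
    · exact main a b hnab h
    · rw [swap_comm a b]
      exact main b a (fun h => hnab h.symm) h

/-- The number of ways to write `σ` as a product of `j` transpositions. -/
noncomputable def numSwapFact : ℕ → Perm α → ℕ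
  | 0, σ => if σ = 1 then 1 else 0
  | j + 1, σ => ∑ τ ∈ swaps α, numSwapFact j (σ * τ)

theorem card_le_card_add_of_numSwapFact_ne_zero {j : ℕ} {σ : Perm α} {S : Finset α}
    (h : numSwapFact j σ ≠ 0) (hS : MeetsCycles σ S) : Fintype.card α ≤ S.card + j := by
  induction j generalizing σ S with
  | zero =>
    have hσ : σ = 1 := by
      by_contra hσ
      exact h (by simp [numSwapFact, hσ])
    subst hσ
    have : S = univ := by
      ext x
      obtain ⟨s, hs, hxs⟩ := hS x
      simpa [sameCycle_one.1 hxs] using hs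
    simp [this]
  | succ j ih =>
    obtain ⟨τ, hτ, hne⟩ := exists_ne_zero_of_sum_ne_zero (f := fun τ => numSwapFact j (σ * τ)) h
    obtain ⟨a, b, -, rfl⟩ := mem_swaps.1 hτ
    have hS' : MeetsCycles (σ * swap a b * swap a b) S := by simpa [mul_assoc] using hS
    rcases hS'.of_mul_swap with h | h
    · have h1 := ih hne h
      have h2 := card_insert_le b S
      omega
    · have h1 := ih hne h
      have h2 := card_insert_le a S
      omega

theorem sum_numSwapFact_mul_numMeeting (j m : ℕ) (hm : m + j + 1 = Fintype.card α) :
    ∑ σ : Perm α, numSwapFact (j + 1) σ * numMeeting m σ =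
      Fintype.card α * m * ∑ σ : Perm α, numSwapFact j σ * numMeeting (m + 1) σ := by
  calc ∑ σ : Perm α, numSwapFact (j + 1) σ * numMeeting m σ
      = ∑ τ ∈ swaps α, ∑ σ : Perm α, numSwapFact j (σ * τ) * numMeeting m σ := by
        rw [sum_comm]
        simp only [numSwapFact, sum_mul]
    _ = ∑ τ ∈ swaps α, ∑ σ : Perm α, numSwapFact j σ * numMeeting m (σ * τ) := by
        refine sum_congr rfl fun τ hτ => ?_
        obtain ⟨a, b, -, rfl⟩ := mem_swaps.1 hτ
        refine Fintype.sum_equiv (Equiv.mulRight (swap a b)) _ _ fun σ => ?_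
        simp [mul_assoc]
    _ = ∑ σ : Perm α, numSwapFact j σ * ∑ τ ∈ swaps α, numMeeting m (σ * τ) := by
        rw [sum_comm]
        simp only [mul_sum]
    _ = ∑ σ : Perm α, numSwapFact j σ * (Fintype.card α * m * numMeeting (m + 1) σ) := by
        refine sum_congr rfl fun σ _ => ?_
        by_cases h0 : numSwapFact j σ = 0
        · simp [h0]
        · rw [sum_swaps_numMeeting]
          intro S hS
          have := card_le_card_add_of_numSwapFact_ne_zero h0 hS
          omega
    _ = _ := by
        rw [mul_sum]
        exact sum_congr rfl fun σ _ => by ring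

theorem numMeeting_card_one : numMeeting (Fintype.card α) (1 : Perm α) = 1 := by
  classical
  rw [numMeeting, card_eq_one]
  refine ⟨univ, ?_⟩
  ext S
  simp only [mem_filter, mem_univ, true_and, mem_singleton, card_eq_iff_eq_univ]
  refine ⟨fun h => h.1, ?_⟩
  rintro rfl
  exact ⟨rfl, fun x => ⟨x, mem_univ x, SameCycle.rfl⟩⟩

theorem sum_numSwapFact_mul_numMeeting_eq (j m : ℕ) (hm : m + 1 + j = Fintype.card α) :
    m.factorial * ∑ σ : Perm α, numSwapFact j σ * numMeeting (m + 1) σ =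
      Fintype.card α ^ j * (Fintype.card α - 1).factorial := by
  induction j generalizing m with
  | zero =>
    have hm' : m + 1 = Fintype.card α := hm
    simp only [numSwapFact, ite_mul, one_mul, zero_mul, sum_ite_eq', mem_univ, if_true]
    rw [hm', numMeeting_card_one, ← hm']
    simp
  | succ j ih =>
    rw [sum_numSwapFact_mul_numMeeting j (m + 1) (by omega), pow_succ]
    have := ih (m + 1) (by omega)
    rw [Nat.factorial_succ] at this
    linear_combination Fintype.card α * this

theorem numSwapFact_conj (j : ℕ) (σ g : Perm α) :
    numSwapFact j (g * σ * g⁻¹) = numSwapFact j σ := by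
  induction j generalizing σ with
  | zero => simp [numSwapFact]
  | succ j ih =>
    have hswap : ∀ (g τ : Perm α), τ ∈ swaps α → g * τ * g⁻¹ ∈ swaps α := by
      intro g τ hτ
      obtain ⟨a, b, hab, rfl⟩ := mem_swaps.1 hτ
      exact mem_swaps.2 ⟨g a, g b, g.injective.ne hab, by
        rw [swap_apply_apply]⟩
    simp only [numSwapFact]
    symm
    refine sum_nbij' (fun τ => g * τ * g⁻¹) (fun τ => g⁻¹ * τ * g) (fun τ => hswap g τ) ?_ ?_ ?_ ?_
    · intro τ hτ
      simpa using hswap g⁻¹ τ hτ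
    · intro τ _
      group
    · intro τ _
      group
    · intro τ _
      rw [← ih (σ * τ)]
      congr 1
      group

theorem cycleType_eq_card_iff (hα : 2 ≤ Fintype.card α) (σ : Perm α) :
    σ.cycleType = {Fintype.card α} ↔ ∀ x y, SameCycle σ x y := by
  constructor
  · intro h x y
    have hc : σ.IsCycle := by
      rw [← card_cycleType_eq_one, h, Multiset.card_singleton]
    have hs : σ.support = univ := by
      rw [← card_eq_iff_eq_univ, ← sum_cycleType, h, Multiset.sum_singleton]
    have : ∀ z, σ z ≠ z := fun z => mem_support.1 (hs ▸ mem_univ z)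
    exact hc.sameCycle (this x) (this y)
  · intro h
    have hne : ∀ x, σ x ≠ x := by
      intro x hx
      have : Nontrivial α := Fintype.one_lt_card_iff_nontrivial.1 hα
      obtain ⟨y, hy⟩ := exists_ne x
      exact hy ((h x y).eq_of_left hx).symm
    have hs : σ.support = univ := by
      ext x
      simpa using hne x
    obtain ⟨x⟩ : Nonempty α := Fintype.card_pos_iff.1 (by omega)
    have hc : σ.IsCycle := ⟨x, hne x, fun y _ => h x y⟩
    rw [hc.cycleType, hs, card_univ]

theorem numMeeting_one (hα : 2 ≤ Fintype.card α) (σ : Perm α) :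
    numMeeting 1 σ = if σ.cycleType = {Fintype.card α} then Fintype.card α else 0 := by
  classical
  rw [numMeeting]
  split_ifs with h
  · rw [cycleType_eq_card_iff hα] at h
    have : ({S : Finset α | S.card = 1 ∧ MeetsCycles σ S} : Finset (Finset α)) =
        powersetCard 1 univ := by
      ext S
      simp only [mem_filter, mem_univ, true_and, mem_powersetCard, subset_univ, and_iff_left_iff_imp]
      intro hS x
      obtain ⟨s, rfl⟩ := card_eq_one.1 hS
      exact ⟨s, mem_singleton_self s, h x s⟩
    rw [this, card_powersetCard, Nat.choose_one_right, card_univ]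
  · rw [card_eq_zero, filter_eq_empty_iff]
    rintro S - ⟨hS, hM⟩
    obtain ⟨s, rfl⟩ := card_eq_one.1 hS
    refine h ((cycleType_eq_card_iff hα σ).2 fun x y => ?_)
    obtain ⟨u, hu, hx⟩ := hM x
    obtain ⟨v, hv, hy⟩ := hM y
    rw [mem_singleton] at hu hv
    subst hu hv
    exact hx.trans hy.symm

theorem numSwapFact_of_cycleType_eq_card (hα : 2 ≤ Fintype.card α) {c : Perm α}
    (hc : c.cycleType = {Fintype.card α}) :
    numSwapFact (Fintype.card α - 1) c = Fintype.card α ^ (Fintype.card α - 2) := by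
  have h := sum_numSwapFact_mul_numMeeting_eq (α := α) (Fintype.card α - 1) 0 (by omega)
  simp only [zero_add, Nat.factorial_zero, one_mul, numMeeting_one hα, mul_ite, mul_zero] at h
  rw [← sum_filter, sum_congr rfl (g := fun _ => numSwapFact (Fintype.card α - 1) c *
      Fintype.card α), sum_const, card_of_cycleType_singleton hα le_rfl, Nat.choose_self,
      mul_one, smul_eq_mul] at h
  · obtain ⟨k, hk⟩ := Nat.exists_eq_add_of_le' hα
    rw [hk] at h ⊢
    simp only [Nat.add_sub_cancel, show k + 2 - 1 = k + 1 by omega] at h ⊢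
    have hf := Nat.factorial_pos (k + 1)
    refine Nat.eq_of_mul_eq_mul_left (Nat.mul_pos hf (show 0 < k + 2 by omega)) ?_
    linear_combination h
  · intro σ hσ
    simp only [mem_filter, mem_univ, true_and] at hσ
    obtain ⟨g, rfl⟩ := isConj_iff.1 (isConj_iff_cycleType_eq.2 (hc.trans hσ.symm))
    rw [numSwapFact_conj]

theorem card_swapFact (j : ℕ) (σ : Perm α) :
    Nat.card {F : Fin j → Perm α // (∀ k, (F k).IsSwap) ∧ (List.ofFn F).reverse.prod = σ} =
      numSwapFact j σ := by
  classical
  induction j generalizing σ with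
  | zero =>
    rw [numSwapFact]
    split_ifs with h
    · subst h
      rw [Nat.card_eq_one_iff_unique]
      exact ⟨inferInstance, ⟨⟨Fin.elim0, by simp⟩⟩⟩
    · rw [Nat.card_eq_zero]
      refine Or.inl ⟨fun F => h ?_⟩
      simpa using F.2.2.symm
  | succ j ih =>
    rw [numSwapFact, ← sum_coe_sort]
    simp_rw [← ih]
    rw [← Nat.card_sigma]
    refine Nat.card_congr
      { toFun := fun F => ⟨⟨F.1 0, mem_swaps.2 (F.2.1 0)⟩, Fin.tail F.1, fun k => F.2.1 k.succ, ?_⟩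
        invFun := fun p => ⟨Fin.cons p.1.1 p.2.1, ?_, ?_⟩
        left_inv := ?_
        right_inv := ?_ }
    · obtain ⟨F, hF, hp⟩ := F
      obtain ⟨a, b, -, hab⟩ := hF 0
      subst hp
      simp [List.ofFn_succ, mul_assoc, hab, Fin.tail_def]
    · exact Fin.cases (mem_swaps.1 p.1.2) p.2.2.1
    · obtain ⟨⟨τ, hτ⟩, F, hF, hp⟩ := p
      obtain ⟨a, b, -, rfl⟩ := mem_swaps.1 hτ
      simp [List.ofFn_succ, hp, mul_assoc]
    · rintro ⟨F, hF⟩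
      simp
    · rintro ⟨⟨τ, hτ⟩, F, hF⟩
      rfl

end Count

end MinimalFactorization

open MinimalFactorization in
/-- the number of minimal factorizations of the `n`-cycle `(1,…,n)`
into `n-1` transpositions is `n^(n-2)`. -/
theorem number_of_minimal_factorizations (n : ℕ) (hn : 2 ≤ n) :
    Nat.card {F : Fin (n - 1) → Equiv.Perm (Fin n) // IsMinFact n F} = n ^ (n - 2) := by
  have h := numSwapFact_of_cycleType_eq_card (α := Fin n) (by simpa using hn)
    (c := finRotate n) (by simpa using cycleType_finRotate_of_le hn)
  rw [Fintype.card_fin] at h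
  rw [← h]
  exact card_swapFact (n - 1) (finRotate n)
end

section
/- For every integer j ≥ 1, the sequence of real numbers n ↦ (number of minimal factorizations F ∈ 𝔐_n with T_1(F) = j) / n^{n-2} converges, as n → ∞, to e^{-1} / (j-1)!. -/
open Finset in
theorem abel_sum_eval (m : ℕ) :
    ∑ s ∈ range (m + 2), (m + 1).choose s * ((m + 1 : ℕ) + 1 - s : ℝ) ^ (m + 1 - s - 1) *
      (-(m + 2 : ℝ) + s) ^ s = 0 := by
  have h := congrFun (fwdDiff_iter_pow_eq_zero_of_lt (R := ℝ) (Nat.lt_succ_self m)) (-(m + 2 : ℝ))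
  rw [fwdDiff_iter_eq_sum_shift] at h
  rw [← neg_eq_zero, ← sum_neg_distrib]
  refine (sum_congr rfl fun s hs => ?_).trans h
  rw [mem_range] at hs
  obtain rfl | hs' : s = m + 1 ∨ s ≤ m := by omega
  · have : (-(m + 2 : ℝ) + (m + 1 : ℕ)) = -1 := by push_cast; ring
    simp only [this]
    norm_num [pow_succ]
  · obtain ⟨d, rfl⟩ := Nat.exists_eq_add_of_le hs'
    have e1 : s + d + 1 - s - 1 = d := by omega
    have e2 : (s + d).succ - s = d + 1 := by omega
    have e3 : ((s + d + 1 : ℕ) + 1 - s : ℝ) = -1 * (-(((s + d : ℕ) : ℝ) + 2) + s) := by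
      push_cast; ring
    rw [e1, e2, e3, mul_pow]
    simp only [zsmul_eq_mul]
    push_cast
    simp
    ring

open Finset in
theorem abel_sum (m : ℕ) : ∀ t : ℝ,
    ∑ s ∈ range (m + 1), m.choose s * (m + 1 - s : ℝ) ^ (m - s - 1) * (t + s) ^ s =
      (t + m + 1) ^ m := by
  induction m with
  | zero => simp
  | succ m ih =>
    intro t
    set f : ℝ → ℝ := fun t => ∑ s ∈ range (m + 1 + 1), (m + 1).choose s *
      ((m + 1 : ℕ) + 1 - s : ℝ) ^ (m + 1 - s - 1) * (t + s) ^ s - (t + (m + 1 : ℕ) + 1) ^ (m + 1)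
      with hf
    have hd : ∀ t, HasDerivAt f 0 t := by
      intro t
      have h1 : ∀ (s : ℕ), HasDerivAt (fun t : ℝ => (m + 1).choose s *
          ((m + 1 : ℕ) + 1 - s : ℝ) ^ (m + 1 - s - 1) * (t + s) ^ s)
          ((m + 1).choose s * ((m + 1 : ℕ) + 1 - s : ℝ) ^ (m + 1 - s - 1) *
            (s * (t + s) ^ (s - 1))) t := fun s => by
        simpa using (((hasDerivAt_id t).add_const (s : ℝ)).pow s).const_mul _
      have h2 : HasDerivAt (fun t : ℝ => (t + (m + 1 : ℕ) + 1) ^ (m + 1))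
          ((m + 1 : ℕ) * (t + (m + 1 : ℕ) + 1) ^ m) t := by
        have := ((hasDerivAt_id t).add_const ((m + 1 : ℕ) + 1 : ℝ)).fun_pow (m + 1)
        simpa [add_assoc] using this
      refine ((HasDerivAt.fun_sum fun s (_ : s ∈ range (m + 1 + 1)) => h1 s).sub h2).congr_deriv ?_
      rw [sum_range_succ', sub_eq_zero]
      have := ih (t + 1)
      rw [show t + (m + 1 : ℕ) + 1 = t + 1 + m + 1 by push_cast; ring, ← this, mul_sum]
      simp only [Nat.cast_zero, zero_mul, mul_zero, add_zero]
      refine sum_congr rfl fun s _ => ?_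
      have hc : (((m + 1).choose (s + 1) : ℕ) : ℝ) * (s + 1) = (m + 1) * m.choose s := by
        exact_mod_cast (Nat.add_one_mul_choose_eq m s).symm
      rw [show m + 1 - (s + 1) - 1 = m - s - 1 by omega, Nat.add_sub_cancel]
      push_cast
      rw [show (m : ℝ) + 1 + 1 - (s + 1) = m + 1 - s by ring,
        show t + ((s : ℝ) + 1) = t + 1 + s by ring]
      linear_combination (m + 1 - s : ℝ) ^ (m - s - 1) * (t + 1 + s) ^ s * hc
    have hconst := is_const_of_deriv_eq_zero (fun t => (hd t).differentiableAt)
      (fun t => (hd t).deriv) t (-(m + 2 : ℝ))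
    have h0 : f (-(m + 2 : ℝ)) = 0 := by
      simp only [hf]
      rw [abel_sum_eval]
      have : -(m + 2 : ℝ) + (m + 1 : ℕ) + 1 = 0 := by push_cast; ring
      rw [this]; simp
    rw [h0] at hconst
    exact sub_eq_zero.mp hconst

/-- The weighted number of ways, up to a factorial, of writing a `k`-cycle as a minimal product of
transpositions, each transposition moving a given point of the cycle having weight `t`. -/
noncomputable def abelWeight (t : ℝ) : ℕ → ℝ
  | 0 => 1
  | 1 => 1
  | k + 2 => t * (t + k + 1) ^ k / (k + 1).factorial

theorem add_mul_abelWeight (t : ℝ) (i : ℕ) :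
    (t + i) * abelWeight t (i + 1) = t * (t + i) ^ i / i.factorial := by
  rcases i with _ | i
  · simp [abelWeight]
  · simp [abelWeight]; ring

theorem abelWeight_one_succ (i : ℕ) :
    abelWeight 1 (i + 1) = (i + 1 : ℝ) ^ (i - 1) / i.factorial := by
  rcases i with _ | i
  · simp [abelWeight]
  · simp [abelWeight]; ring

theorem abelWeight_recurrence (t : ℝ) (k : ℕ) :
    (k + 1) * abelWeight t (k + 2) =
      ∑ d ∈ Finset.range (k + 1),
        (t + (k - d : ℕ)) * abelWeight t (k - d + 1) * abelWeight 1 (d + 1) := by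
  have h := abel_sum k t
  rw [← Finset.sum_range_reflect] at h
  have hk : (k.factorial : ℝ) ≠ 0 := by positivity
  have hw : abelWeight t (k + 2) = t * (t + k + 1) ^ k / (k + 1).factorial := rfl
  rw [hw, Nat.factorial_succ, Nat.cast_mul, ← h, Finset.mul_sum, Finset.sum_div, Finset.mul_sum]
  refine Finset.sum_congr rfl fun d hd => ?_
  have hd' : d ≤ k := Nat.lt_succ_iff.mp (Finset.mem_range.mp hd)
  obtain ⟨s, rfl⟩ := Nat.exists_eq_add_of_le' hd'
  rw [add_mul_abelWeight, abelWeight_one_succ]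
  simp only [show s + d + 1 - 1 - d = s by omega, show s + d - s = d by omega,
    show s + d - d = s by omega]
  have hc : ((s + d).choose s : ℝ) = (s + d).factorial / (s.factorial * d.factorial) := by
    rw [Nat.cast_add_choose]
  rw [hc]
  have : ((s + d + 1 : ℕ) : ℝ) ≠ 0 := by positivity
  push_cast at this ⊢
  field_simp
  ring_nf

open Filter Topology in
theorem tendsto_choose_mul_pow_div (k : ℕ) :
    Tendsto (fun m : ℕ => (m.choose k * (m + 1 : ℝ) ^ (m - k)) / (m + 2 : ℝ) ^ m)
      atTop (𝓝 (Real.exp (-1) / k.factorial)) := by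
  have h := ProbabilityTheory.tendsto_choose_mul_pow_of_tendsto_mul_atTop (r := 1)
    (p := fun n => 1 / (n + 2 : ℝ)) k ?_
  · simp only [one_pow, mul_one] at h
    refine h.congr' ?_
    filter_upwards [eventually_ge_atTop k] with m hm
    have : (m + 2 : ℝ) ≠ 0 := by positivity
    obtain ⟨d, rfl⟩ := Nat.exists_eq_add_of_le hm
    have e : 1 - 1 / ((k + d : ℕ) + 2 : ℝ) = ((k + d : ℕ) + 1 : ℝ) / ((k + d : ℕ) + 2 : ℝ) := by
      field_simp; ring
    simp only [e, div_pow, Nat.add_sub_cancel_left, pow_add, one_pow]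
    field_simp
  · have := (tendsto_natCast_div_add_atTop (2 : ℝ))
    simpa [div_eq_mul_inv] using this

open Equiv Equiv.Perm

section
variable {α : Type*} [DecidableEq α]

theorem formPerm_append_mul_swap_getLast (D : List α) (hD : D ≠ []) :
    ∀ (B : List α) (hB : B ≠ []), (B ++ D).Nodup →
      (B ++ D).formPerm * swap (D.getLast hD) (B.getLast hB) = B.formPerm * D.formPerm
  | [], hB, _ => absurd rfl hB
  | [b], _, h => by
    obtain ⟨d, D', rfl⟩ := List.exists_cons_of_ne_nil hD
    have hb : (d :: D').formPerm b = b := List.formPerm_apply_of_notMem (by simp_all)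
    have hl : (d :: D').formPerm ((d :: D').getLast hD) = d := List.formPerm_apply_getLast d D'
    rw [List.singleton_append, List.formPerm_cons_cons, List.getLast_singleton, mul_assoc,
      mul_swap_eq_swap_mul, hb, hl, swap_comm d b, swap_mul_self_mul, List.formPerm_singleton,
      one_mul]
  | b :: b' :: B, _, h => by
    have := formPerm_append_mul_swap_getLast D hD (b' :: B) (by simp) (List.Nodup.of_cons h)
    rw [List.cons_append, List.cons_append, List.formPerm_cons_cons, List.getLast_cons (by simp),
      mul_assoc, ← List.cons_append, this, List.formPerm_cons_cons, mul_assoc]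

variable [Fintype α]

theorem Equiv.Perm.IsCycle.mul_swap_pow_apply {c : Perm α} (hc : c.IsCycle) {y : α} (hy : y ∈ c.support)
    {i d : ℕ} (h : i + d + 1 < c.support.card) :
    ∃ B D : List α, B.length = d + 1 ∧ D.length = c.support.card - (d + 1) ∧ (B ++ D).Nodup ∧
      (B ++ D).toFinset = c.support ∧ y ∈ D ∧
      c * swap ((c ^ i) y) ((c ^ (i + d + 1)) y) = B.formPerm * D.formPerm := by
  set L := c.toList y with hL
  have hlen : L.length = c.support.card := by
    rw [hL, length_toList, hc.cycleOf_eq (mem_support.mp hy)]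
  have hform : L.formPerm = c := by
    rw [hL, formPerm_toList, hc.cycleOf_eq (mem_support.mp hy)]
  have hnd : L.Nodup := nodup_toList c y
  have hget : ∀ k (hk : k < L.length), L[k] = (c ^ k) y := fun k hk => getElem_toList c y k hk
  set A := L.take (i + 1)
  set R := L.drop (i + 1)
  set B := R.take (d + 1)
  set C := R.drop (d + 1)
  have hAR : A ++ R = L := List.take_append_drop _ _
  have hBC : B ++ C = R := List.take_append_drop _ _
  have hA : A.length = i + 1 := by simp [A]; omega
  have hR : R.length = L.length - (i + 1) := by simp [R]
  have hB : B.length = d + 1 := by simp [B]; omega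
  have hC : C.length = R.length - (d + 1) := by simp [C]
  have hA0 : A ≠ [] := by rintro h; simp [h] at hA
  have hB0 : B ≠ [] := by rintro h; simp [h] at hB
  have hrot : L ~r (B ++ (C ++ A)) := by
    rw [← hAR, ← hBC, ← List.append_assoc B]
    exact List.isRotated_append
  have hnd' : (B ++ (C ++ A)).Nodup := hrot.nodup_iff.mp hnd
  have hform' : c = (B ++ (C ++ A)).formPerm := by
    rw [← List.formPerm_eq_of_isRotated hnd hrot, hform]
  have hlA : (C ++ A).getLast (by simp [hA0]) = (c ^ i) y := by
    rw [List.getLast_append_of_ne_nil _ hA0, List.getLast_eq_getElem, ← hget i (by omega)]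
    simp [A, hA]
  have hlB : B.getLast hB0 = (c ^ (i + d + 1)) y := by
    rw [List.getLast_eq_getElem, ← hget _ (by omega)]
    simp only [B, R, List.getElem_take, List.getElem_drop, List.length_take, List.length_drop]
    congr 1; omega
  refine ⟨B, C ++ A, hB, ?_, hnd', ?_, ?_, ?_⟩
  · simp; omega
  · rw [← List.toFinset_eq_of_perm _ _ hrot.perm]
    ext z
    rw [List.mem_toFinset, hL, mem_toList_iff]
    refine ⟨fun h => h.1.mem_support_iff.mp h.2, fun h => ⟨hc.sameCycle ?_ ?_, hy⟩⟩
    · exact mem_support.mp hy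
    · exact mem_support.mp h
  · refine List.mem_append_right _ ?_
    have : y = A[0] := by
      simp only [A, List.getElem_take]
      rw [hget]; simp
    rw [this]; exact List.getElem_mem _
  · have := formPerm_append_mul_swap_getLast (C ++ A) (by simp [hA0]) B hB0 hnd'
    rwa [← hform', hlA, hlB] at this
end
open Equiv Equiv.Perm in
theorem List.Nodup.disjoint_formPerm {α : Type*} [DecidableEq α] {B D : List α}
    (h : (B ++ D).Nodup) : B.formPerm.Disjoint D.formPerm := by
  intro z
  by_cases hz : z ∈ B
  · exact Or.inr (List.formPerm_apply_of_notMem fun hz' => List.disjoint_of_nodup_append h hz hz')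
  · exact Or.inl (List.formPerm_apply_of_notMem hz)

section
variable {α M : Type*} [DecidableEq α] [Fintype α] [CommMonoid M]

/-- The product, over the nontrivial cycles of a permutation, of a weight of their supports. -/
@[to_additive]
def cycleProd (w : Finset α → M) (σ : Equiv.Perm α) : M :=
  ∏ c ∈ σ.cycleFactorsFinset, w c.support

@[to_additive]
theorem cycleProd_mul (w : Finset α → M) {σ τ : Equiv.Perm α} (h : σ.Disjoint τ) :
    cycleProd w (σ * τ) = cycleProd w σ * cycleProd w τ := by
  rw [cycleProd, h.cycleFactorsFinset_mul_eq_union,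
    Finset.prod_union h.disjoint_cycleFactorsFinset]
  rfl

@[to_additive]
theorem cycleProd_of_isCycle (w : Finset α → M) {c : Equiv.Perm α} (hc : c.IsCycle) :
    cycleProd w c = w c.support := by
  rw [cycleProd, hc.cycleFactorsFinset_eq_singleton, Finset.prod_singleton]

@[to_additive]
theorem cycleProd_formPerm (w : Finset α → M) (hw : ∀ a, w {a} = 1) {l : List α} (hl : l.Nodup)
    (hl0 : l ≠ []) : cycleProd w l.formPerm = w l.toFinset := by
  match l, hl0 with
  | [a], _ => simp [cycleProd, hw]
  | a :: b :: l, _ =>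
    rw [cycleProd_of_isCycle w (List.isCycle_formPerm hl (by simp)),
      List.support_formPerm_of_nodup _ hl (by simp)]

/-- Removing a cycle from a permutation and replacing it with two disjoint ones. -/
@[to_additive]
theorem cycleProd_mul_of_split (w : Finset α → M) (hw : ∀ a, w {a} = 1) {σ c τ : Equiv.Perm α}
    (hc : c ∈ σ.cycleFactorsFinset) {B D : List α} (hB : B ≠ []) (hD : D ≠ [])
    (h : (B ++ D).Nodup) (hBD : (B ++ D).toFinset = c.support)
    (hτ : c * τ = B.formPerm * D.formPerm) :
    cycleProd w (σ * τ) = cycleProd w (σ * c⁻¹) * (w B.toFinset * w D.toFinset) := by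
  have hdis := Equiv.Perm.disjoint_mul_inv_of_mem_cycleFactorsFinset hc
  have hdis' : (σ * c⁻¹).Disjoint (B.formPerm * D.formPerm) := by
    rw [Equiv.Perm.disjoint_iff_disjoint_support] at hdis ⊢
    refine hdis.mono_right ((Equiv.Perm.support_mul_le _ _).trans ?_)
    rw [← hBD, List.toFinset_append]
    exact sup_le_sup (List.support_formPerm_le B) (List.support_formPerm_le D)
  rw [show σ * τ = σ * c⁻¹ * (c * τ) by group, hτ, cycleProd_mul w hdis',
    cycleProd_mul w h.disjoint_formPerm, cycleProd_formPerm w hw h.of_append_left hB,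
    cycleProd_formPerm w hw h.of_append_right hD]

@[to_additive]
theorem cycleProd_eq_of_mem (w : Finset α → M) {σ c : Equiv.Perm α}
    (hc : c ∈ σ.cycleFactorsFinset) : cycleProd w σ = cycleProd w (σ * c⁻¹) * w c.support := by
  have hdis := Equiv.Perm.disjoint_mul_inv_of_mem_cycleFactorsFinset hc
  rw [← cycleProd_of_isCycle w (Equiv.Perm.mem_cycleFactorsFinset_iff.mp hc).1,
    ← cycleProd_mul w hdis, inv_mul_cancel_right]
end

section
open Equiv Equiv.Perm Finset
variable {α : Type*} [DecidableEq α] [Fintype α]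

/-- The smallest number of transpositions whose product is `σ`. -/
def reflLength : Perm α → ℕ := cycleSum fun s => s.card - 1

theorem Equiv.Perm.IsCycle.pow_apply_inj {c : Perm α} (hc : c.IsCycle) {y : α} (hy : y ∈ c.support)
    {i j : ℕ} (hi : i < c.support.card) (hj : j < c.support.card) :
    (c ^ i) y = (c ^ j) y ↔ i = j := by
  have hlen : (c.toList y).length = c.support.card := by
    rw [length_toList, hc.cycleOf_eq (mem_support.mp hy)]
  rw [← getElem_toList c y i (by omega), ← getElem_toList c y j (by omega)]
  exact (nodup_toList c y).getElem_inj_iff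

theorem reflLength_mul_swap_add_one_of_sameCycle {σ : Perm α} {a b : α} (hab : a ≠ b)
    (h : σ.SameCycle a b) : reflLength (σ * swap a b) + 1 = reflLength σ := by
  have ha : a ∈ σ.support := by
    rw [mem_support]; exact fun ha => hab (h.eq_of_left ha)
  set c := σ.cycleOf a with hcdef
  have hc : c ∈ σ.cycleFactorsFinset := cycleOf_mem_cycleFactorsFinset_iff.mpr ha
  have hcyc : c.IsCycle := (mem_cycleFactorsFinset_iff.mp hc).1
  have hac : a ∈ c.support := mem_support_cycleOf_iff.mpr ⟨SameCycle.refl _ _, ha⟩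
  have hbc : b ∈ c.support := mem_support_cycleOf_iff.mpr ⟨h, ha⟩
  obtain ⟨j, hj, hjb⟩ := (hcyc.sameCycle (mem_support.mp hac) (mem_support.mp hbc)).exists_pow_eq'
  rw [hcyc.orderOf] at hj
  obtain _ | d := j
  · exact absurd hjb hab
  obtain ⟨B, D, hB, hD, hnd, hBD, hy, hmul⟩ :=
    hcyc.mul_swap_pow_apply hac (i := 0) (d := d) (by omega)
  rw [Nat.zero_add, pow_zero, one_apply, hjb] at hmul
  have hw : ∀ a : α, ({a} : Finset α).card - 1 = 0 := by simp
  rw [reflLength, cycleSum_add_of_split _ hw hc (by rintro rfl; simp at hB)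
    (List.ne_nil_of_mem hy) hnd hBD hmul, cycleSum_eq_of_mem _ hc,
    List.toFinset_card_of_nodup hnd.of_append_left, List.toFinset_card_of_nodup hnd.of_append_right]
  have := List.length_pos_of_mem hy
  omega

theorem sameCycle_mul_swap {σ : Perm α} {a b : α} (h : ¬ σ.SameCycle a b) :
    (σ * swap a b).SameCycle a b := by
  have key : ∀ k < Function.minimalPeriod σ b, ((σ * swap a b) ^ (k + 1)) a = (σ ^ (k + 1)) b := by
    intro k
    induction k with
    | zero => simp
    | succ k ih =>
      intro hk
      have h1 : (σ ^ (k + 1)) b ≠ a := fun e => h (SameCycle.symm ⟨(k + 1 : ℕ), by rwa [zpow_natCast]⟩)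
      have h2 : (σ ^ (k + 1)) b ≠ b := fun e =>
        Function.not_isPeriodicPt_of_pos_of_lt_minimalPeriod (Nat.succ_ne_zero k) hk (by
          rwa [Function.IsPeriodicPt, Function.IsFixedPt, iterate_eq_pow])
      rw [pow_succ', mul_apply, ih (by omega), mul_apply, swap_apply_of_ne_of_ne h1 h2,
        pow_succ' σ (k + 1), mul_apply]
  have hpos : 0 < Function.minimalPeriod σ b :=
    Function.minimalPeriod_pos_of_mem_periodicPts (by
      refine ⟨orderOf σ, orderOf_pos σ, ?_⟩
      rw [Function.IsPeriodicPt, Function.IsFixedPt, iterate_eq_pow, pow_orderOf_eq_one, one_apply])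
  refine ⟨Function.minimalPeriod σ b, ?_⟩
  have := key (Function.minimalPeriod σ b - 1) (by omega)
  rw [Nat.sub_add_cancel hpos] at this
  rw [zpow_natCast, this, ← iterate_eq_pow]
  exact Function.iterate_minimalPeriod

theorem reflLength_mul_swap_of_not_sameCycle {σ : Perm α} {a b : α} (h : ¬ σ.SameCycle a b) :
    reflLength (σ * swap a b) = reflLength σ + 1 := by
  have hab : a ≠ b := by rintro rfl; exact h (SameCycle.refl _ _)
  have := reflLength_mul_swap_add_one_of_sameCycle hab (sameCycle_mul_swap h)
  rwa [mul_swap_mul_self, eq_comm] at this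
end

section
open Equiv Equiv.Perm Finset
variable {α : Type*} [DecidableEq α] [Fintype α]

theorem Equiv.Perm.IsCycle.swap_pow_apply_inj {c : Perm α} (hc : c.IsCycle) {y : α}
    (hy : y ∈ c.support) {i j i' j' : ℕ} (hij : i < j) (hij' : i' < j') (hj : j < c.support.card)
    (hj' : j' < c.support.card)
    (h : swap ((c ^ i) y) ((c ^ j) y) = swap ((c ^ i') y) ((c ^ j') y)) : i = i' ∧ j = j' := by
  have hinj {p q : ℕ} (hp : p < c.support.card) (hq : q < c.support.card) :=
    hc.pow_apply_inj hy hp hq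
  have hne : (c ^ i) y ≠ (c ^ j) y := by rw [Ne, hinj (by omega) hj]; omega
  have hne' : (c ^ i') y ≠ (c ^ j') y := by rw [Ne, hinj (by omega) hj']; omega
  have hs := congrArg support h
  rw [support_swap hne, support_swap hne'] at hs
  have h1 : (c ^ i) y ∈ ({(c ^ i') y, (c ^ j') y} : Finset α) := by rw [← hs]; simp
  have h2 : (c ^ j) y ∈ ({(c ^ i') y, (c ^ j') y} : Finset α) := by rw [← hs]; simp
  rw [mem_insert, mem_singleton, hinj (by omega) (by omega), hinj (by omega) (by omega)] at h1 h2
  omega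

open Classical in
theorem Equiv.Perm.IsCycle.sum_isSwap {M : Type*} [AddCommMonoid M] {c : Perm α} (hc : c.IsCycle)
    {y : α} (hy : y ∈ c.support) (f : Perm α → M) :
    ∑ τ : Perm α with τ.IsSwap ∧ τ.support ⊆ c.support, f τ =
      ∑ d ∈ range (c.support.card - 1), ∑ i ∈ range (c.support.card - 1 - d),
        f (swap ((c ^ i) y) ((c ^ (i + d + 1)) y)) := by
  rw [Finset.sum_sigma', eq_comm]
  have hpow (k : ℕ) : (c ^ k) y ∈ c.support := pow_apply_mem_support.mpr hy
  refine Finset.sum_nbij (fun p : (_ : ℕ) × ℕ => swap ((c ^ p.2) y) ((c ^ (p.2 + p.1 + 1)) y))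
    ?_ ?_ ?_ fun _ _ => rfl
  · rintro ⟨d, i⟩ h
    simp only [mem_sigma, mem_range] at h
    have hne : (c ^ i) y ≠ (c ^ (i + d + 1)) y := by
      rw [Ne, hc.pow_apply_inj hy (by omega) (by omega)]; omega
    simp only [mem_filter, mem_univ, true_and]
    refine ⟨⟨_, _, hne, rfl⟩, ?_⟩
    rw [support_swap hne, insert_subset_iff, singleton_subset_iff]
    exact ⟨hpow _, hpow _⟩
  · rintro ⟨d, i⟩ h ⟨d', i'⟩ h' e
    simp only [coe_sigma, Set.mem_sigma_iff, mem_coe, mem_range] at h h'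
    dsimp only at e
    obtain ⟨rfl, h2⟩ := hc.swap_pow_apply_inj hy (by omega) (by omega) (by omega) (by omega) e
    obtain rfl : d = d' := by omega
    rfl
  · intro τ hτ
    simp only [coe_filter, mem_univ, true_and, Set.mem_ofPred_eq] at hτ
    obtain ⟨⟨a, b, hab, rfl⟩, hs⟩ := hτ
    rw [support_swap hab, insert_subset_iff, singleton_subset_iff] at hs
    obtain ⟨i, hi, rfl⟩ :=
      (hc.sameCycle (mem_support.mp hy) (mem_support.mp hs.1)).exists_pow_eq'
    obtain ⟨j, hj, rfl⟩ :=
      (hc.sameCycle (mem_support.mp hy) (mem_support.mp hs.2)).exists_pow_eq'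
    rw [hc.orderOf] at hi hj
    have hij : i ≠ j := by rintro rfl; exact hab rfl
    obtain h | h := lt_or_gt_of_ne hij
    · refine ⟨⟨j - i - 1, i⟩, ?_, ?_⟩
      · simp only [coe_sigma, Set.mem_sigma_iff, mem_coe, mem_range]; omega
      · simp only [show i + (j - i - 1) + 1 = j by omega]
    · refine ⟨⟨i - j - 1, j⟩, ?_, ?_⟩
      · simp only [coe_sigma, Set.mem_sigma_iff, mem_coe, mem_range]; omega
      · simp only [show j + (i - j - 1) + 1 = i by omega, swap_comm]

/-- The weight `t` of a permutation moving `x`; the other ones have weight `1`. -/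
noncomputable def moveWeight (x : α) (t : ℝ) (τ : Perm α) : ℝ := if τ x ≠ x then t else 1

/-- The weighted number, up to a factorial, of minimal factorizations of a cycle of support `s`. -/
noncomputable def cycleWeight (x : α) (t : ℝ) (s : Finset α) : ℝ :=
  abelWeight (if x ∈ s then t else 1) s.card

theorem cycleWeight_singleton {α : Type*} [DecidableEq α] (x : α) (t : ℝ) (a : α) : cycleWeight x t {a} = 1 := by
  simp [cycleWeight, abelWeight]

open Classical in
theorem sum_isSwap_cycleProd_of_mem (x : α) (t : ℝ) {σ c : Perm α}
    (hc : c ∈ σ.cycleFactorsFinset) :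
    ∑ τ : Perm α with τ.IsSwap ∧ τ.support ⊆ c.support,
        moveWeight x t τ * cycleProd (cycleWeight x t) (σ * τ) =
      (c.support.card - 1 : ℕ) * cycleProd (cycleWeight x t) σ := by
  have hcyc : c.IsCycle := (mem_cycleFactorsFinset_iff.mp hc).1
  obtain ⟨y, hy, hxy⟩ : ∃ y ∈ c.support, x ∈ c.support → y = x := by
    by_cases hx : x ∈ c.support
    · exact ⟨x, hx, fun _ => rfl⟩
    · obtain ⟨y, hy⟩ := hcyc.nonempty_support
      exact ⟨y, hy, fun h => absurd h hx⟩
  obtain ⟨k, hk⟩ := Nat.exists_eq_add_of_le' hcyc.two_le_card_support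
  set t' := if x ∈ c.support then t else 1 with ht'
  have hterm : ∀ d i, i + d + 1 < c.support.card →
      moveWeight x t (swap ((c ^ i) y) ((c ^ (i + d + 1)) y)) *
        cycleProd (cycleWeight x t) (σ * swap ((c ^ i) y) ((c ^ (i + d + 1)) y)) =
      (if i = 0 then t' else 1) * (cycleProd (cycleWeight x t) (σ * c⁻¹) *
        (abelWeight 1 (d + 1) * abelWeight t' (k - d + 1))) := by
    intro d i h
    obtain ⟨B, D, hB, hD, hnd, hBD, hyD, hmul⟩ := hcyc.mul_swap_pow_apply hy h
    have hBx : x ∉ B := fun hx => by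
      have hxc : x ∈ c.support := by
        rw [← hBD, List.mem_toFinset]; exact List.mem_append_left _ hx
      exact List.disjoint_of_nodup_append hnd hx (hxy hxc ▸ hyD)
    have hDx : x ∈ D ↔ x ∈ c.support := by
      refine ⟨fun hx => ?_, fun hx => hxy hx ▸ hyD⟩
      rw [← hBD, List.mem_toFinset]; exact List.mem_append_right _ hx
    rw [cycleProd_mul_of_split _ (cycleWeight_singleton x t) hc (by rintro rfl; simp at hB)
      (List.ne_nil_of_mem hyD) hnd hBD hmul]
    have e1 : cycleWeight x t B.toFinset = abelWeight 1 (d + 1) := by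
      rw [cycleWeight, List.toFinset_card_of_nodup hnd.of_append_left, hB]
      simp [hBx]
    have e2 : cycleWeight x t D.toFinset = abelWeight t' (k - d + 1) := by
      rw [cycleWeight, List.toFinset_card_of_nodup hnd.of_append_right, hD, ht']
      simp only [List.mem_toFinset, hDx]
      congr 1; omega
    have e3 : moveWeight x t (swap ((c ^ i) y) ((c ^ (i + d + 1)) y)) =
        if i = 0 then t' else 1 := by
      have hne : (c ^ i) y ≠ (c ^ (i + d + 1)) y := by
        rw [Ne, hcyc.pow_apply_inj hy (by omega) (by omega)]; omega
      have hpow (k : ℕ) : (c ^ k) y ∈ c.support := pow_apply_mem_support.mpr hy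
      simp only [moveWeight, ← mem_support, support_swap hne, mem_insert, mem_singleton]
      by_cases hx : x ∈ c.support
      · obtain rfl := hxy hx
        have h0 (j : ℕ) (hj : j < c.support.card) : y = (c ^ j) y ↔ j = 0 := by
          rw [eq_comm, ← hcyc.pow_apply_inj hy hj (by omega), pow_zero, one_apply]
        simp [h0 i (by omega), h0 (i + d + 1) h, ht', hx]
      · rw [if_neg, ht', if_neg hx, ite_self]
        rintro (rfl | rfl)
        · exact hx (hpow _)
        · exact hx (hpow _)
    rw [e1, e2, e3]
  rw [hcyc.sum_isSwap hy, cycleProd_eq_of_mem _ hc, cycleWeight, ← ht', hk]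
  have hrec := abelWeight_recurrence t' k
  rw [show k + 2 - 1 = k + 1 by omega]
  rw [Nat.cast_succ, mul_left_comm, hrec, mul_sum]
  refine sum_congr rfl fun d hd => ?_
  rw [mem_range] at hd
  rw [sum_congr rfl fun i hi => hterm d i (by rw [mem_range] at hi; omega), ← sum_mul,
    show k + 1 - d = k - d + 1 by omega, sum_range_succ']
  simp
  ring

theorem eq_of_support_subset_of_mem_cycleFactorsFinset {σ τ c c' : Perm α} (hτ : τ.IsSwap)
    (hc : c ∈ σ.cycleFactorsFinset) (hc' : c' ∈ σ.cycleFactorsFinset)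
    (h : τ.support ⊆ c.support) (h' : τ.support ⊆ c'.support) : c = c' := by
  obtain ⟨a, b, hab, rfl⟩ := hτ
  have ha : a ∈ (swap a b).support := by rw [support_swap hab]; simp
  by_contra hne
  exact Finset.disjoint_left.mp (cycleFactorsFinset_pairwise_disjoint σ hc hc' hne).disjoint_support
    (h ha) (h' ha)

open Classical in
theorem sum_isSwap_cycleProd (x : α) (t : ℝ) (σ : Perm α) :
    ∑ τ : Perm α with τ.IsSwap ∧ ∃ c ∈ σ.cycleFactorsFinset, τ.support ⊆ c.support,
        moveWeight x t τ * cycleProd (cycleWeight x t) (σ * τ) =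
      reflLength σ * cycleProd (cycleWeight x t) σ := by
  have : ({τ : Perm α | τ.IsSwap ∧ ∃ c ∈ σ.cycleFactorsFinset, τ.support ⊆ c.support} : Finset _) =
      σ.cycleFactorsFinset.biUnion fun c => {τ : Perm α | τ.IsSwap ∧ τ.support ⊆ c.support} := by
    ext τ
    simp only [mem_filter, mem_univ, true_and, mem_biUnion]
    tauto
  rw [this, sum_biUnion, sum_congr rfl fun c hc => sum_isSwap_cycleProd_of_mem x t hc, ← sum_mul,
    ← Nat.cast_sum]
  · rfl
  · intro c hc c' hc' hne
    refine Finset.disjoint_left.mpr fun τ h h' => hne ?_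
    simp only [mem_filter, mem_univ, true_and] at h h'
    exact eq_of_support_subset_of_mem_cycleFactorsFinset h.1 hc hc' h.2 h'.2

open Classical in
/-- The weighted number of factorizations of `σ` into `ℓ` transpositions. -/
noncomputable def swapFactSum (x : α) (t : ℝ) : ℕ → Perm α → ℝ
  | 0, σ => if σ = 1 then 1 else 0
  | ℓ + 1, σ => ∑ τ : Perm α with τ.IsSwap, moveWeight x t τ * swapFactSum x t ℓ (σ * τ)

theorem reflLength_mul_isSwap (σ : Perm α) {τ : Perm α} (hτ : τ.IsSwap) :
    ((∃ c ∈ σ.cycleFactorsFinset, τ.support ⊆ c.support) ∧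
        reflLength (σ * τ) + 1 = reflLength σ) ∨
      ((¬∃ c ∈ σ.cycleFactorsFinset, τ.support ⊆ c.support) ∧
        reflLength (σ * τ) = reflLength σ + 1) := by
  obtain ⟨a, b, hab, rfl⟩ := hτ
  rw [support_swap hab]
  simp only [insert_subset_iff, singleton_subset_iff]
  by_cases h : σ.SameCycle a b
  · refine Or.inl ⟨⟨σ.cycleOf a, ?_, ?_, ?_⟩, reflLength_mul_swap_add_one_of_sameCycle hab h⟩
    all_goals
      have ha : a ∈ σ.support := by
        rw [mem_support]; exact fun ha => hab (h.eq_of_left ha)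
    · exact cycleOf_mem_cycleFactorsFinset_iff.mpr ha
    · exact mem_support_cycleOf_iff.mpr ⟨SameCycle.refl _ _, ha⟩
    · exact mem_support_cycleOf_iff.mpr ⟨h, ha⟩
  · refine Or.inr ⟨?_, reflLength_mul_swap_of_not_sameCycle h⟩
    rintro ⟨c, hc, ha, hb⟩
    rw [cycle_is_cycleOf ha hc] at hb
    exact h (mem_support_cycleOf_iff.mp hb).1

theorem swapFactSum_eq (x : α) (t : ℝ) (ℓ : ℕ) : ∀ σ : Perm α, ℓ ≤ reflLength σ →
    swapFactSum x t ℓ σ =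
      if reflLength σ = ℓ then ℓ.factorial * cycleProd (cycleWeight x t) σ else 0 := by
  classical
  induction ℓ with
  | zero =>
    intro σ _
    have : σ = 1 ↔ reflLength σ = 0 := by
      refine ⟨by rintro rfl; simp [reflLength, cycleSum], fun h => ?_⟩
      rw [reflLength, cycleSum, sum_eq_zero_iff] at h
      rw [← cycleFactorsFinset_eq_empty_iff, eq_empty_iff_forall_notMem]
      intro c hc
      have := h c hc
      have := (mem_cycleFactorsFinset_iff.mp hc).1.two_le_card_support
      omega
    simp only [swapFactSum, ← this]
    split_ifs with h
    · simp [h, cycleProd]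
    · rfl
  | succ ℓ ih =>
    intro σ hσ
    have hle (τ : Perm α) (hτ : τ.IsSwap) : ℓ ≤ reflLength (σ * τ) := by
      obtain h | h := reflLength_mul_isSwap σ hτ <;> omega
    rw [swapFactSum]
    split_ifs with h
    · rw [Nat.factorial_succ, mul_comm (ℓ + 1), Nat.cast_mul, mul_assoc, ← h,
        ← sum_isSwap_cycleProd, mul_sum, ← filter_filter,
        sum_filter (fun τ : Perm α => ∃ c ∈ σ.cycleFactorsFinset, τ.support ⊆ c.support)]
      refine sum_congr rfl fun τ hτ => ?_
      have hτ' := (mem_filter.mp hτ).2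
      rw [ih _ (hle τ hτ')]
      obtain ⟨h1, h2⟩ | ⟨h1, h2⟩ := reflLength_mul_isSwap σ hτ'
      · rw [if_pos (by omega), if_pos h1]; ring
      · rw [if_neg (by omega), if_neg h1, mul_zero]
    · refine sum_eq_zero fun τ hτ => ?_
      have hτ' := (mem_filter.mp hτ).2
      rw [ih _ (hle τ hτ'), if_neg, mul_zero]
      obtain h | h := reflLength_mul_isSwap σ hτ' <;> omega
end

section
open Equiv Equiv.Perm Finset
variable {α : Type*} [DecidableEq α] [Fintype α]

open Classical in
theorem swapFactSum_eq_sum (x : α) (t : ℝ) (ℓ : ℕ) : ∀ σ : Perm α,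
    swapFactSum x t ℓ σ =
      ∑ F : Fin ℓ → Perm α with (∀ k, (F k).IsSwap) ∧ (List.ofFn F).reverse.prod = σ,
        ∏ k, moveWeight x t (F k) := by
  induction ℓ with
  | zero => intro σ; by_cases h : σ = 1 <;> simp [swapFactSum, h, eq_comm]
  | succ ℓ ih =>
    intro σ
    rw [swapFactSum, sum_filter, sum_filter,
      ← (Fin.consEquiv fun _ : Fin (ℓ + 1) => Perm α).sum_comp, Fintype.sum_prod_type]
    refine sum_congr rfl fun τ _ => ?_
    by_cases hτ : τ.IsSwap
    · rw [if_pos hτ, ih, mul_sum, sum_filter]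
      refine sum_congr rfl fun F _ => ?_
      have hiff : (List.ofFn F).reverse.prod = σ * τ ↔ (List.ofFn F).reverse.prod * τ = σ := by
        obtain ⟨a, b, -, rfl⟩ := hτ
        rw [← mul_inv_eq_iff_eq_mul, swap_inv]
      simp [Fin.consEquiv, Fin.forall_fin_succ, hτ, Fin.prod_univ_succ, hiff, List.ofFn_succ]
    · rw [if_neg hτ, eq_comm]
      refine sum_eq_zero fun F _ => if_neg fun h => hτ ?_
      simpa [Fin.consEquiv] using h.1 0

theorem prod_moveWeight {n : ℕ} (F : Fin (n - 1) → Perm (Fin n)) (x : Fin n) (t : ℝ) :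
    ∏ k, moveWeight x t (F k) = t ^ Tcount F x := by
  simp [moveWeight, Tcount, prod_ite]

open Classical in
theorem sum_isMinFact_pow_Tcount (m : ℕ) (x : Fin (m + 2)) (t : ℝ) :
    ∑ F : Fin (m + 2 - 1) → Perm (Fin (m + 2)) with IsMinFact (m + 2) F, t ^ Tcount F x =
      t * (t + (m + 1)) ^ m := by
  have hcyc : (finRotate (m + 2)).IsCycle := isCycle_finRotate
  have hlen : reflLength (finRotate (m + 2)) = m + 1 := by
    rw [reflLength, cycleSum_of_isCycle _ hcyc, support_finRotate]; simp
  have h := swapFactSum_eq x t (m + 1) (finRotate (m + 2)) hlen.ge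
  rw [if_pos hlen, cycleProd_of_isCycle _ hcyc, support_finRotate, swapFactSum_eq_sum,
    cycleWeight, if_pos (mem_univ x), card_univ, Fintype.card_fin] at h
  have hw : abelWeight t (m + 2) = t * (t + m + 1) ^ m / (m + 1).factorial := rfl
  have hf : ((m + 1).factorial : ℝ) ≠ 0 := by positivity
  rw [hw, mul_div_cancel₀ _ hf, add_assoc] at h
  rw [← h]
  exact sum_congr (by ext F; simp only [mem_filter]; rfl) fun F _ => (prod_moveWeight F x t).symm

open Polynomial in
theorem card_isMinFact_Tcount_eq (m : ℕ) (x : Fin (m + 2)) (k : ℕ) :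
    (Nat.card {F : Fin (m + 2 - 1) → Perm (Fin (m + 2)) //
      IsMinFact (m + 2) F ∧ Tcount F x = k + 1} : ℝ) = m.choose k * (m + 1 : ℝ) ^ (m - k) := by
  classical
  have hpoly : ∑ F : Fin (m + 2 - 1) → Perm (Fin (m + 2)) with IsMinFact (m + 2) F,
      (X : ℝ[X]) ^ Tcount F x = X * (X + C (m + 1 : ℝ)) ^ m := by
    refine Polynomial.funext fun t => ?_
    simpa [eval_finsetSum] using sum_isMinFact_pow_Tcount m x t
  have h := congrArg (coeff · (k + 1)) hpoly
  simp only [finsetSum_coeff, coeff_X_pow, coeff_X_mul, coeff_X_add_C_pow] at h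
  rw [mul_comm, ← h, Nat.card_eq_fintype_card, Fintype.card_subtype, ← filter_filter, sum_boole]
  simp only [eq_comm]
end

/-- for `j ≥ 1`, the proportion of minimal factorizations of size `n`
with `T_1 = j` tends to `e⁻¹ / (j-1)!` as `n → ∞` (the sequence is indexed by
`n = m + 2` so that it ranges over all sizes `n ≥ 2`; the element `1` of `{1,…,n}`
is the index `0 : Fin n`). -/
theorem limit_T1 (j : ℕ) (hj : 1 ≤ j) :
    Filter.Tendsto (fun m : ℕ =>
      (Nat.card {F : Fin ((m + 2) - 1) → Equiv.Perm (Fin (m + 2)) //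
          IsMinFact (m + 2) F ∧ Tcount F ⟨0, by omega⟩ = j} : ℝ) /
        ((m + 2 : ℝ) ^ ((m + 2) - 2)))
      Filter.atTop (nhds (Real.exp (-1) / (Nat.factorial (j - 1) : ℝ))) := by
  obtain ⟨k, rfl⟩ := Nat.exists_eq_add_of_le' hj
  simp only [card_isMinFact_Tcount_eq, Nat.add_sub_cancel]
  exact tendsto_choose_mul_pow_div k
end

section
/- The sequence of real numbers n ↦ (number of minimal factorizations F = (τ_1, …, τ_{n-1}) ∈ 𝔐_n such that τ_1 τ_2 ⋯ τ_k(1) ≤ ⌊n/2⌋ for every 1 ≤ k ≤ n-1) / n^{n-2} converges, as n → ∞, to 1 - e^{-1}. -/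
section Step
open Equiv
universe u
variable {α : Type*} [LinearOrder α]

/-- Every cycle of `σ` visits its elements in increasing order, up to the choice of its
starting point. -/
def IncreasingCycles (σ : Perm α) : Prop :=
  ∀ x y, σ.SameCycle x y → (x < y → x < σ x ∧ σ x ≤ y) ∧ (σ x ≤ x → σ x ≤ y)

/-- A unit-step flow along the cycles of `ρ`, in which `c x` units enter at `x`, and one unit is
absorbed by each `x` with `x < ρ x`. -/
structure IsFlow (ρ : Perm α) (c h : α → ℕ) : Prop where
  balance : ∀ z, h z + c (ρ z) = h (ρ z) + if ρ z < ρ (ρ z) then 1 else 0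
  vanish : ∀ z, ρ z ≤ z → h z = 0

/-- `ρ` arises from `σ` by exchanging the values `i` at `x` and `j` at `y`, in such a way that the
set of exceedances grows by `x`. -/
structure IsStep (σ ρ : Perm α) (i j x y : α) : Prop where
  lt : i < j
  sx : σ x = i
  sy : σ y = j
  rx : ρ x = j
  ry : ρ y = i
  off : ∀ z, z ≠ x → z ≠ y → ρ z = σ z
  le_x : i ≤ x
  x_lt : x < j
  y_lt : y < j → y < i

omit [LinearOrder α] in
theorem label_eq_of_sameCycle {L : Type*} {σ : Perm α} (r : α → L) (hr : ∀ x, r (σ x) = r x)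
    {x y : α} (h : σ.SameCycle x y) : r x = r y := by
  obtain ⟨k, rfl⟩ := h
  have key : ∀ (n : ℕ) x, r ((σ ^ n) x) = r x := by
    intro n
    induction n with
    | zero => simp
    | succ n ih => intro x; rw [pow_succ', Perm.mul_apply, hr, ih]
  cases k with
  | ofNat n => simpa using (key n x).symm
  | negSucc n =>
    have := key (n + 1) ((σ ^ (Int.negSucc n)) x)
    rw [← this, zpow_negSucc]
    simp

theorem IncreasingCycles.of_label {L : Type*} {σ : Perm α} (r : α → L) (hr : ∀ x, r (σ x) = r x)
    (h : ∀ x y, r x = r y → (x < y → x < σ x ∧ σ x ≤ y) ∧ (σ x ≤ x → σ x ≤ y)) :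
    IncreasingCycles σ := fun x y hxy => h x y (label_eq_of_sameCycle r hr hxy)

theorem exists_label {α : Type u} (σ : Perm α) :
    ∃ (L : Type u) (r : α → L), (∀ x, r (σ x) = r x) ∧ ∀ x y, r x = r y ↔ σ.SameCycle x y := by
  refine ⟨Quotient (Perm.SameCycle.setoid σ), fun x => Quotient.mk _ x, fun x => ?_, fun x y => ?_⟩
  · exact Quotient.sound (s := Perm.SameCycle.setoid σ) (by
      change σ.SameCycle (σ x) x
      simpa using Perm.SameCycle.refl σ x)
  · exact ⟨fun h => Quotient.exact (s := Perm.SameCycle.setoid σ) h,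
      fun h => Quotient.sound (s := Perm.SameCycle.setoid σ) h⟩

namespace IsStep
variable {σ ρ : Perm α} {i j x y : α}

theorem lt_apply (hs : IsStep σ ρ i j x y) {z : α} (hz : z < σ z) : z < ρ z := by
  obtain ⟨h1, h2, h3, h4, h5, h6, h7, h8, h9⟩ := hs
  have := h6 z
  by_cases hx : z = x
  · grind
  by_cases hy : z = y <;> grind

theorem symm_lt (hs : IsStep σ ρ i j x y) {z : α} (hz : σ.symm z < z) : ρ.symm z < z := by
  obtain ⟨h1, h2, h3, h4, h5, h6, h7, h8, h9⟩ := hs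
  obtain ⟨w, rfl⟩ := σ.surjective z
  by_cases hx : w = x
  · grind
  by_cases hy : w = y
  · subst hy
    rw [h3, ← h4]
    grind
  · rw [← h6 w hx hy]; grind

theorem not_sameCycle (hs : IsStep σ ρ i j x y) (hσ : IncreasingCycles σ) :
    ¬ σ.SameCycle i j := by
  obtain ⟨h1, h2, h3, h4, h5, h6, h7, h8, h9⟩ := hs
  intro h
  have : σ.SameCycle x j := by subst h2; simpa using h
  have := (hσ x j this).1 h8
  grind

theorem sameCycle_of_sameCycle [Finite α] (hs : IsStep σ ρ i j x y) (hσ : IncreasingCycles σ)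
    (z : α) (hz : σ.SameCycle z i) : ρ.SameCycle z x := by
  have hji := hs.not_sameCycle hσ
  obtain ⟨h1, h2, h3, h4, h5, h6, h7, h8, h9⟩ := hs
  induction z using WellFoundedGT.induction with
  | ind z ih =>
    by_cases hx : z = x
    · subst hx; exact Perm.SameCycle.refl _ _
    have hzx : σ.SameCycle z x := by subst h2; simpa using hz
    have hlt : z < x := by
      rcases lt_or_gt_of_ne hx with h | h
      · exact h
      · have := (hσ x z hzx.symm).1 h
        grind
    have hy : z ≠ y := by
      rintro rfl
      apply hji
      rw [← h3]
      simpa using hz.symm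
    have h := (hσ z x hzx).1 hlt
    have := ih (σ z) h.1 (by simpa using hz)
    rw [← h6 z hx hy] at this
    simpa using this

theorem increasingCycles_flow (hs : IsStep σ ρ i j x y) (hσ : IncreasingCycles σ) :
    IncreasingCycles ρ ∧ (∀ z, ρ.SameCycle z i → i ≤ z → z ≤ x → σ.SameCycle z i) := by
  have hji := hs.not_sameCycle hσ
  obtain ⟨L, r, hr, hr'⟩ := exists_label σ
  have hrσ : ∀ x y, r x = r y → (x < y → x < σ x ∧ σ x ≤ y) ∧ (σ x ≤ x → σ x ≤ y) :=
    fun x y h => hσ x y ((hr' x y).1 h)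
  rw [← hr'] at hji
  have hrx : r x = r i := by rw [← hs.sx, hr]
  have hry : r y = r j := by rw [← hs.sy, hr]
  have hmax : ∀ z, r z = r i → i ≤ z ∧ z ≤ x := by
    intro z hz
    have := hrσ x z (hrx.trans hz.symm)
    have := hs.sx
    have := hs.le_x
    grind
  have hgap : ∀ z, r z = r j → i ≤ z → j ≤ z := by
    intro z hz hiz
    have := hrσ y z (hry.trans hz.symm)
    have := hs.sy
    have := hs.y_lt
    grind
  obtain ⟨h1, h2, h3, h4, h5, h6, h7, h8, h9⟩ := hs
  classical
  let r' : α → L := fun z => if r z = r i then r j else r z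
  have hr1 : ∀ z, r' (ρ z) = r' z := by
    intro z
    by_cases hx : z = x
    · subst hx; simp [r', h4, hrx]
    by_cases hy : z = y
    · subst hy; simp [r', h5, hry]
    · simp [r', h6 z hx hy, hr]
  refine ⟨.of_label r' hr1 ?_, ?_⟩
  · intro u w huw
    have e1 := hmax u
    have e2 := hmax w
    have e3 := hgap u
    have e4 := hgap w
    have e5 := hrσ u w
    have e6 := hrσ u x
    have e7 := hrσ u j
    have e8 := hrσ u y
    have e9 := h6 u
    have e10 := hrσ y w
    have e16 := hrσ y u
    have e17 := hrσ y (σ u)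
    have e18 := hr u
    have e11 := h6 x
    have e12 : w = y → r w = r y := fun h => by rw [h]
    have e13 : u = y → r u = r y := fun h => by rw [h]
    have e14 : u = x → ρ u = ρ x := fun h => by rw [h]
    have e15 : u = y → ρ u = ρ y := fun h => by rw [h]
    simp only [r'] at huw
    clear hr1 r' hgap hmax hrσ hr' hr h6 hσ
    by_cases hu : r u = r i
    · by_cases hw : r w = r i
      · by_cases hux : u = x
        · grind
        · grind
      · by_cases hux : u = x
        · grind
        · grind
    · by_cases hw : r w = r i
      · have huj : r u = r j := by simpa [hu, hw] using huw
        obtain ⟨hiw, hwx⟩ := e2 hw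
        by_cases huy : u = y
        · refine ⟨fun h => ?_, fun h => ?_⟩
          · have : y < i := h9 (by order)
            rw [e15 huy, h5, huy]
            exact ⟨this, hiw⟩
          · rw [e15 huy, h5]; exact hiw
        · have e8' := e8 (huj.trans hry.symm)
          have e7' := e7 huj
          have hux : u ≠ x := by rintro rfl; exact hu hrx
          rw [e9 hux huy]
          have e16' := e16 (hry.trans huj.symm)
          rw [h3] at e16'
          have hyu : u < y ∨ y < u := lt_or_gt_of_ne huy
          have hσj : σ u ≠ j := by rw [← h3]; exact fun h => huy (σ.injective h)
          refine ⟨fun h => ?_, fun h => ?_⟩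
          · refine ⟨(e7'.1 (by order)).1, ?_⟩
            rcases le_or_gt j y with hjy | hjy
            · have := e16'.2 hjy
              order
            · have := h9 hjy
              rcases hyu with hyu | hyu
              · have := (e8'.1 hyu).2
                order
              · have := (e16'.1 hyu).2
                order
          · rcases le_or_gt j y with hjy | hjy
            · have := e17 ((hry.trans huj.symm).trans (e18).symm) 
              rw [h3] at this
              have := this.2 hjy
              have := e7'.2 h
              order
            · have := h9 hjy
              have := e8'.2 h
              order
      · have huw' : r u = r w := by simpa [hu, hw] using huw
        by_cases huy : u = y
        · have e10' := e10 (by rw [← huy, huw'])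
          rw [h3] at e10'
          rw [e15 huy, h5, huy]
          refine ⟨fun h => ?_, fun h => ?_⟩
          · have := e10'.1 h
            have := h9 this.1
            exact ⟨this, by order⟩
          · have : j ≤ y := by
              by_contra hc
              have := h9 (not_le.1 hc)
              order
            have := e10'.2 this
            order
        · rw [e9 (by rintro rfl; exact hu hrx) huy]
          exact e5 huw'
  · intro z hz h8 h9
    have := label_eq_of_sameCycle r' hr1 hz
    rw [← hr']
    have := hgap z
    simp only [r', if_true] at *
    grind

theorem exists_flow (hs : IsStep σ ρ i j x y) (hσ : IncreasingCycles σ) {c h : α → ℕ}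
    (hf : IsFlow σ c h) :
    ∃ h', IsFlow ρ (fun z => c z + if z = i then 1 else 0) h' ∧ h' x = h' y ∧
      ∀ z, σ.SameCycle z i → z < x → h' y < h' z := by
  have hji := hs.not_sameCycle hσ
  obtain ⟨L, r, hr, hr'⟩ := exists_label σ
  have hrσ : ∀ x y, r x = r y → (x < y → x < σ x ∧ σ x ≤ y) ∧ (σ x ≤ x → σ x ≤ y) :=
    fun x y h => hσ x y ((hr' x y).1 h)
  rw [← hr'] at hji
  have hrx : r x = r i := by rw [← hs.sx, hr]
  have hry : r y = r j := by rw [← hs.sy, hr]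
  simp only [← hr']
  have hlt : ∀ z, z < σ z → z < ρ z := fun z => hs.lt_apply
  obtain ⟨h1, h2, h3, h4, h5, h6, h7, h8, h9⟩ := hs
  obtain ⟨b, v⟩ := hf
  have hx0 : h x = 0 := v x (by grind)
  classical
  refine ⟨fun z => if z = x then h y else if r z = r i then h z + h y + 1 else h z, ⟨?_, ?_⟩, ?_, ?_⟩
  · intro z
    have b1 := b z
    have b2 := b x
    have b3 := b y
    have e1 := hr z
    have e2 := h6 z
    have e3 := h6 (ρ z)
    have inj := σ.injective
    have i1 := @inj z x
    have i2 := @inj z y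
    have i3 := @inj x y
    have e4 := hrσ x (ρ z)
    have hj := hr j
    have hi := hr i
    have e6i := h6 i
    have e6j := h6 j
    have e7 := hlt x
    by_cases hx : z = x
    · have hjx : j ≠ x := by order
      have hjr : r j ≠ r i := fun h => hji h.symm
      have hcmp : j < ρ j ↔ j < σ j := by
        by_cases hjy : j = y
        · have : ρ j = i := by rw [hjy, h5]
          have : σ j = j := by rw [hjy, h3, hjy]
          constructor <;> intro h <;> order
        · rw [e6j hjx hjy]
      rw [hx, h4, if_pos rfl, if_neg hjx, if_neg hjr, if_neg h1.ne']
      simp only [hcmp]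
      rw [h3] at b3
      simpa using b3
    by_cases hy : z = y
    · subst hy
      rw [h5]
      grind
    · rw [e2 hx hy]
      have hzi : σ z ≠ i := fun h => hx (i1 (by rw [h, h2]))
      rw [if_neg hzi]
      by_cases hwx : σ z = x
      · rw [hwx] at e1 b1 ⊢
        grind
      by_cases hwy : σ z = y
      · rw [hwy] at e1 b1 ⊢
        grind
      · rw [h6 _ hwx hwy]
        grind
  · intro z hz
    have hzx : z ≠ x := by rintro rfl; order
    have hσz : σ z ≤ z := not_lt.1 fun h => absurd (hlt z h) (by order)
    have hri : r z ≠ r i := by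
      intro hri
      have a1 := (hrσ z x (hri.trans hrx.symm)).1
      have a2 := (hrσ x z (hrx.trans hri.symm)).1
      rcases lt_or_gt_of_ne hzx with h | h
      · have := (a1 h).1
        order
      · have := (a2 h).1
        order
    rw [if_neg hzx, if_neg hri, v z hσz]
  · grind
  · intro z hz hzx
    grind

end IsStep

theorem IsFlow.unique [Finite α] {ρ : Perm α} {c h h' : α → ℕ} (hf : IsFlow ρ c h)
    (hf' : IsFlow ρ c h') : h = h' := by
  funext z
  induction z using WellFoundedGT.induction with
  | ind z ih =>
    rcases le_or_gt (ρ z) z with hz | hz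
    · rw [hf.vanish z hz, hf'.vanish z hz]
    · have := ih _ hz
      have := hf.balance z
      have := hf'.balance z
      omega

theorem IsFlow.exists_step [Finite α] {ρ : Perm α} (hρ : IncreasingCycles ρ) {c h : α → ℕ} (i : α)
    (hf : IsFlow ρ (fun z => c z + if z = i then 1 else 0) h) :
    ∃ (σ : Perm α) (j x y : α), IsStep σ ρ i j x y ∧ σ = swap i j * ρ ∧ IncreasingCycles σ ∧
      ∃ h', IsFlow σ c h' := by
  obtain ⟨L, r, hr, hr'⟩ := exists_label ρ
  have hrσ : ∀ x y, r x = r y → (x < y → x < ρ x ∧ ρ x ≤ y) ∧ (ρ x ≤ x → ρ x ≤ y) :=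
    fun x y h => hρ x y ((hr' x y).1 h)
  obtain ⟨y, hy⟩ := ρ.surjective i
  have hry : r y = r i := by rw [← hy, hr]
  have hv := hf.vanish
  have hb := hf.balance
  have hS : ∃ x, (r x = r i ∧ i ≤ x ∧ h x ≤ h y) ∧
      ∀ z, r z = r i ∧ i ≤ z ∧ h z ≤ h y → x ≤ z := by
    have hne : ∃ z, r z = r i ∧ i ≤ z ∧ h z ≤ h y := by
      have : ∀ z, r z = r i → i ≤ z → ∃ z, r z = r i ∧ i ≤ z ∧ h z ≤ h y := by
        intro z
        induction z using WellFoundedGT.induction with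
        | ind z ih =>
          intro h1 h2
          rcases le_or_gt (ρ z) z with hz | hz
          · exact ⟨z, h1, h2, by rw [hv z hz]; omega⟩
          · exact ih _ hz (by rw [hr, h1]) (h2.trans hz.le)
      exact this i rfl le_rfl
    obtain ⟨x, hx, hmin⟩ := WellFounded.has_min (wellFounded_lt (α := α))
      {z | r z = r i ∧ i ≤ z ∧ h z ≤ h y} hne
    exact ⟨x, hx, fun z hz => not_lt.1 (hmin z hz)⟩
  obtain ⟨x, ⟨hrx, hix, hxy⟩, hmin⟩ := hS
  have hkey : x < ρ x ∧ h x = h y := by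
    by_cases hxi : x = i
    · subst hxi
      have := hb y
      rw [hy] at this
      simp only [if_true] at this
      split_ifs at this with h1
      · exact ⟨h1, by omega⟩
      · omega
    · obtain ⟨p, hp⟩ := ρ.surjective x
      have hrp : r p = r i := by rw [← hrx, ← hp, hr]
      have e1 := hrσ p i hrp
      have e2 := hmin p
      have e3 := hb p
      rw [hp] at e1 e3
      have : h y < h p := by grind
      split_ifs at e3 <;> first | omega | (constructor <;> first | assumption | omega)
  obtain ⟨hxlt, hxh⟩ := hkey
  set j := ρ x with hj
  have hrj : r j = r i := by rw [hj, hr, hrx]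
  have hji : j ≠ i := by grind
  have hxny : x ≠ y := by rintro rfl; exact hji hy
  have hoff : ∀ z, z ≠ x → z ≠ y → (swap i j * ρ) z = ρ z := by
    intro z hzx hzy
    rw [Perm.mul_apply, swap_apply_of_ne_of_ne]
    · rw [← hy]; exact fun h => hzy (ρ.injective h)
    · exact fun h => hzx (ρ.injective h)
  have hsx : (swap i j * ρ) x = i := by rw [Perm.mul_apply, ← hj, swap_apply_right]
  have hsy : (swap i j * ρ) y = j := by rw [Perm.mul_apply, hy, swap_apply_left]
  have hyj := hrσ y j (hry.trans hrj.symm)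
  have hyj' : i ≤ y → j ≤ y := by
    intro h
    by_contra hc
    have := (hyj.1 (not_le.1 hc)).1
    rw [hy] at this
    order
  have hyi := hrσ y i hry
  have hys := hrσ y x (hry.trans hrx.symm)
  have hstep : IsStep (swap i j * ρ) ρ i j x y :=
    ⟨by grind, hsx, hsy, rfl, hy, fun z h1 h2 => (hoff z h1 h2).symm, hix, hxlt, by grind⟩
  generalize hσ : swap i j * ρ = σ at *
  have hclosed : ∀ z, z ≠ x → z ≠ y →
      ((r (ρ z) = r i ∧ i ≤ ρ z ∧ ρ z ≤ x) ↔ (r z = r i ∧ i ≤ z ∧ z ≤ x)) := by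
    intro z hzx hzy
    rw [hr]
    have e1 := hrσ z x
    have e2 := hrσ z i
    have i0 : ρ z ≠ i := fun h => hzy (ρ.injective (h.trans hy.symm))
    constructor
    · rintro ⟨hz, h1, h2⟩
      have e1 := e1 (hz.trans hrx.symm)
      have e2 := e2 hz
      refine ⟨hz, ?_, ?_⟩
      · by_contra hc
        have := (e2.1 (not_le.1 hc)).2
        order
      · by_contra hc
        rcases le_or_gt (ρ z) z with hle | hle
        · have := e2.2 hle
          order
        · order
    · rintro ⟨hz, h1, h2⟩
      have := (e1 (hz.trans hrx.symm)).1 (by order)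
      exact ⟨hz, by order, this.2⟩
  refine ⟨σ, j, x, y, hstep, hσ.symm, ?_, ?_⟩
  · let r' : α → Prop × L := fun z => (r z = r i ∧ i ≤ z ∧ z ≤ x, r z)
    apply IncreasingCycles.of_label r'
    · intro z
      by_cases hzx : z = x
      · subst hzx
        simp only [r', hsx, hrx, Prod.mk.injEq, and_true]
        grind
      by_cases hzy : z = y
      · subst hzy
        simp only [r', hsy, hrj, hry, Prod.mk.injEq, and_true]
        grind
      · simp only [r', hoff z hzx hzy, hr, Prod.mk.injEq, and_true]
        exact propext (by simpa [hr] using hclosed z hzx hzy)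
    · intro u w huw
      simp only [r', Prod.mk.injEq, eq_iff_iff] at huw
      have e1 := hrσ u w huw.2
      by_cases hux : u = x
      · have hw := huw.1.1 (by rw [hux]; exact ⟨hrx, hix, le_rfl⟩)
        rw [hux, hsx]
        exact ⟨fun h => absurd h (not_lt.2 hw.2.2), fun _ => hw.2.1⟩
      by_cases huy : u = y
      · have hrw : r w = r i := by rw [← huw.2, huy, hry]
        have hxw := hrσ x w (hrx.trans hrw.symm)
        have hyw := hrσ y w (hry.trans hrw.symm)
        have hw : i ≤ w → j ≤ w := by
          intro hiw
          rcases le_or_gt w x with h | h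
          · have := huw.1.2 ⟨hrw, hiw, h⟩
            rw [huy] at this
            have := hyj' this.2.1
            order
          · exact (hxw.1 h).2
        rw [hy] at hyw hyj
        rw [huy, hsy]
        refine ⟨fun h => ?_, fun h => ?_⟩
        · have := hyw.1 h
          exact ⟨by order, hw this.2⟩
        · exact hw (hyw.2 (by order))
      · rw [hoff u hux huy]
        exact e1
  · classical
    refine ⟨fun z => if r z = r i ∧ i ≤ z ∧ z ≤ x then h z - h y - 1 else h z, ⟨?_, ?_⟩⟩
    · intro z
      have hinC : z ≠ x → z ≠ y → ((r (ρ z) = r i ∧ i ≤ ρ z ∧ ρ z ≤ x) ↔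
          (r z = r i ∧ i ≤ z ∧ z ≤ x)) := fun h1 h2 => hclosed z h1 h2
      have b1 := hb z
      have bx := hb x
      have by' := hb y
      have hjx : j ≠ x := by order
      have hjC : ¬ (r j = r i ∧ i ≤ j ∧ j ≤ x) := by rintro ⟨-, -, h⟩; order
      have hyC : ¬ (r y = r i ∧ i ≤ y ∧ y ≤ x) := by
        rintro ⟨-, h1, h2⟩
        have := hyj' h1
        order
      have hxC : r x = r i ∧ i ≤ x ∧ x ≤ x := ⟨hrx, hix, le_rfl⟩
      have hiC : r i = r i ∧ i ≤ i ∧ i ≤ x := ⟨rfl, le_rfl, hix⟩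
      have hgt : ∀ z, (r z = r i ∧ i ≤ z ∧ z ≤ x) → z ≠ x → h y < h z := by
        intro z hz hzx
        by_contra hc
        exact hzx (le_antisymm hz.2.2 (hmin z ⟨hz.1, hz.2.1, not_lt.1 hc⟩))
      by_cases hzx : z = x
      · rw [hzx, hsx, if_pos hxC, if_pos hiC]
        rw [hy, if_pos rfl] at by'
        by_cases hxi : i = x
        · have : i < ρ i := by rw [hxi]; order
          have h3 : ¬ i < σ i := by rw [hxi, hsx]; order
          rw [if_pos this] at by'
          rw [if_neg h3]
          rw [hxi] at by' ⊢
          omega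
        · have hiy : i ≠ y := by rintro rfl; exact hyC hiC
          rw [hoff i hxi hiy]
          have := hgt i hiC hxi
          split_ifs at by' ⊢ <;> omega
      by_cases hzy : z = y
      · have hcmp : j < ρ j ↔ j < σ j := by
          by_cases hjy : j = y
          · have : ρ j = i := by rw [hjy, hy]
            have : σ j = j := by rw [hjy, hsy, hjy]
            constructor <;> intro h <;> order
          · rw [hoff j hjx hjy]
        rw [hzy, hsy, if_neg hyC, if_neg hjC]
        rw [← hj, if_neg hji] at bx
        simp only [← hcmp]
        omega
      · have i0 : ρ z ≠ i := fun h => hzy (ρ.injective (h.trans hy.symm))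
        have hC := hinC hzx hzy
        rw [if_neg i0] at b1
        rw [hoff z hzx hzy]
        by_cases hwx : ρ z = x
        · have hzC := hC.1 (by rw [hwx]; exact hxC)
          have := hgt z hzC hzx
          rw [hwx] at b1 ⊢
          rw [if_pos hxlt] at b1
          have h0 : ¬ x < σ x := by rw [hsx]; order
          rw [if_pos hzC, if_pos hxC, if_neg h0]
          omega
        by_cases hwy : ρ z = y
        · have hzC : ¬ (r z = r i ∧ i ≤ z ∧ z ≤ x) := fun h => hyC (hwy ▸ hC.2 h)
          have hcmp : y < ρ y ↔ y < σ y := by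
            rw [hsy, hy]
            constructor
            · intro h; order
            · intro h
              by_contra hc
              have := hyj' (by order)
              order
          rw [hwy] at b1 ⊢
          rw [if_neg hyC, if_neg hzC]
          simp only [← hcmp]
          omega
        · rw [hoff _ hwx hwy]
          by_cases hzC : r z = r i ∧ i ≤ z ∧ z ≤ x
          · rw [if_pos hzC, if_pos (hC.2 hzC)]
            have := hgt z hzC hzx
            have := hgt _ (hC.2 hzC) hwx
            omega
          · rw [if_neg hzC, if_neg (fun h => hzC (hC.1 h))]
            omega
    · intro z hz
      by_cases hzx : z = x
      · rw [hzx, if_pos ⟨hrx, hix, le_rfl⟩]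
        omega
      by_cases hzy : z = y
      · rw [hzy, hsy] at hz
        have := hv y (by order)
        rw [hzy]
        split_ifs <;> omega
      · rw [hoff z hzx hzy] at hz
        have := hv z hz
        split_ifs <;> omega

end Step

section Climb
open Equiv
universe u
variable {α : Type*} [LinearOrder α] [Fintype α]

/-- The set of points that `σ` moves upwards. -/
def exceedances (σ : Perm α) : Finset α := Finset.univ.filter fun x => x < σ x

theorem mem_exceedances {σ : Perm α} {x : α} : x ∈ exceedances σ ↔ x < σ x := by
  simp [exceedances]

theorem exceedances_swap_mul_subset (σ : Perm α) {i j : α} (hij : i < j) :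
    exceedances (swap i j * σ) ⊆ insert (σ.symm i) (exceedances σ) := by
  intro z hz
  rw [mem_exceedances, Perm.mul_apply] at hz
  rw [Finset.mem_insert, mem_exceedances, or_iff_not_imp_left]
  intro hzi
  have h1 : σ z ≠ i := fun h => hzi (by rw [← h, symm_apply_apply])
  by_cases h2 : σ z = j
  · rw [h2, swap_apply_right] at hz
    rw [h2]
    exact hz.trans hij
  · rwa [swap_apply_of_ne_of_ne h1 h2] at hz

theorem card_exceedances_swap_mul_le (σ : Perm α) {i j : α} (hij : i < j) :
    (exceedances (swap i j * σ)).card ≤ (exceedances σ).card + 1 :=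
  (Finset.card_le_card (exceedances_swap_mul_subset σ hij)).trans (Finset.card_insert_le _ _)

theorem isStep_of_card_exceedances {σ : Perm α} {i j : α} (hij : i < j)
    (h : (exceedances (swap i j * σ)).card = (exceedances σ).card + 1) :
    IsStep σ (swap i j * σ) i j (σ.symm i) (σ.symm j) := by
  have hsub := exceedances_swap_mul_subset σ hij
  have hx : σ.symm i ∉ exceedances σ := by
    intro hx
    have := Finset.card_le_card hsub
    rw [Finset.insert_eq_of_mem hx] at this
    omega
  have heq : exceedances (swap i j * σ) = insert (σ.symm i) (exceedances σ) :=
    Finset.eq_of_subset_of_card_le hsub (by rw [Finset.card_insert_of_notMem hx, h])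
  have hmem : σ.symm i ∈ exceedances (swap i j * σ) := by rw [heq]; simp
  simp only [mem_exceedances, Perm.mul_apply, apply_symm_apply, swap_apply_left, not_lt] at hx hmem
  refine ⟨hij, by simp, by simp, by simp, by simp, fun z h1 h2 => ?_, hx, hmem, fun h => ?_⟩
  · rw [Perm.mul_apply, swap_apply_of_ne_of_ne]
    · intro h; exact h1 (by rw [← h, symm_apply_apply])
    · intro h; exact h2 (by rw [← h, symm_apply_apply])
  · have : σ.symm j ∈ exceedances (swap i j * σ) := by
      rw [heq, Finset.mem_insert, mem_exceedances]
      right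
      simpa using h
    simpa [mem_exceedances] using this

theorem IsStep.card_exceedances {σ ρ : Perm α} {i j x y : α} (hs : IsStep σ ρ i j x y) :
    (exceedances ρ).card = (exceedances σ).card + 1 := by
  have hx : x ∉ exceedances σ := by
    rw [mem_exceedances, hs.sx]
    exact not_lt.2 hs.le_x
  rw [← Finset.card_insert_of_notMem hx]
  congr 1
  ext z
  rw [Finset.mem_insert, mem_exceedances, mem_exceedances]
  constructor
  · intro h
    by_cases hzx : z = x
    · exact Or.inl hzx
    right
    by_cases hzy : z = y
    · rw [hzy, hs.ry] at h
      rw [hzy, hs.sy]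
      exact h.trans hs.lt
    · rwa [← hs.off z hzx hzy]
  · rintro (rfl | h)
    · rw [hs.rx]; exact hs.x_lt
    · exact hs.lt_apply h

theorem IsStep.fst_eq {σ σ' ρ : Perm α} {i j j' x x' y : α} {c h h' : α → ℕ}
    (hs : IsStep σ ρ i j x y) (hs' : IsStep σ' ρ i j' x' y)
    (hσ : IncreasingCycles σ) (hσ' : IncreasingCycles σ')
    (hf : IsFlow σ c h) (hf' : IsFlow σ' c h') : x = x' := by
  wlog hle : x ≤ x' generalizing σ σ' j j' x x' h h'
  · exact (this hs' hs hσ' hσ hf' hf (not_le.1 hle).le).symm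
  by_contra hne
  obtain ⟨g, hg, hgx, -⟩ := hs.exists_flow hσ hf
  obtain ⟨g', hg', -, hg''⟩ := hs'.exists_flow hσ' hf'
  obtain rfl := hg.unique hg'
  have h1 := hs.sameCycle_of_sameCycle hσ i (Perm.SameCycle.refl _ _)
  have h2 := (hs'.increasingCycles_flow hσ').2 x h1.symm hs.le_x hle
  exact absurd hgx (hg'' x h2 (lt_of_le_of_ne hle hne)).ne'

theorem IncreasingCycles.eq_one_of_exceedances {σ : Perm α} (hσ : IncreasingCycles σ)
    (h : (exceedances σ).card = 0) : σ = 1 := by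
  rw [Finset.card_eq_zero] at h
  have h1 : ∀ x, σ x ≤ x := by
    intro x
    by_contra hx
    have : x ∈ exceedances σ := mem_exceedances.2 (not_le.1 hx)
    simp [h] at this
  have h2 : ∀ x, σ x = x := by
    intro x
    refine le_antisymm (h1 x) ?_
    have : σ.SameCycle (σ x) x := by simpa using Perm.SameCycle.refl σ x
    by_contra hx
    exact absurd ((hσ _ _ this).1 (not_le.1 hx)).1 (not_lt.2 (h1 _))
  ext x
  simp [h2]

/-- The product of the transpositions exchanging the two entries of each pair. -/
def swapProd (L : List (α × α)) : Perm α := (L.map fun p => swap p.1 p.2).prod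

omit [Fintype α] in
@[simp] theorem swapProd_nil : swapProd ([] : List (α × α)) = 1 := rfl

omit [Fintype α] in
@[simp] theorem swapProd_cons (p : α × α) (L : List (α × α)) :
    swapProd (p :: L) = swap p.1 p.2 * swapProd L := by simp [swapProd]

/-- Lists of increasing pairs for which each transposition creates one exceedance. -/
structure IsClimb (L : List (α × α)) : Prop where
  lt : ∀ p ∈ L, p.1 < p.2
  card : (exceedances (swapProd L)).card = L.length

theorem card_exceedances_swapProd_le {L : List (α × α)} (hL : ∀ p ∈ L, p.1 < p.2) :
    (exceedances (swapProd L)).card ≤ L.length := by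
  induction L with
  | nil => simp [exceedances]
  | cons p L ih =>
    rw [swapProd_cons]
    have := card_exceedances_swap_mul_le (swapProd L) (hL p (by simp))
    have := ih fun q hq => hL q (by simp [hq])
    simp only [List.length_cons]
    omega

namespace IsClimb

theorem of_cons {p : α × α} {L : List (α × α)} (h : IsClimb (p :: L)) :
    IsClimb L ∧ IsStep (swapProd L) (swapProd (p :: L)) p.1 p.2
      ((swapProd L).symm p.1) ((swapProd L).symm p.2) := by
  have hlt : ∀ q ∈ L, q.1 < q.2 := fun q hq => h.lt q (by simp [hq])
  have h1 := card_exceedances_swapProd_le hlt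
  have h2 := card_exceedances_swap_mul_le (swapProd L) (h.lt p (by simp))
  have h3 := h.card
  rw [swapProd_cons, List.length_cons] at h3
  refine ⟨⟨hlt, by omega⟩, ?_⟩
  rw [swapProd_cons]
  exact isStep_of_card_exceedances (h.lt p (by simp)) (by omega)

theorem of_suffix {M L : List (α × α)} (h : IsClimb L) (hM : M <:+ L) : IsClimb M := by
  induction L with
  | nil => rwa [List.suffix_nil.1 hM]
  | cons p L ih =>
    rcases List.suffix_cons_iff.1 hM with rfl | hM
    · exact h
    · exact ih h.of_cons.1 hM

theorem increasingCycles_flow {L : List (α × α)} (h : IsClimb L) :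
    IncreasingCycles (swapProd L) ∧
      ∃ g, IsFlow (swapProd L) (fun z => (L.map Prod.fst).count z) g := by
  induction L with
  | nil =>
    refine ⟨?_, fun _ => 0, by constructor <;> simp⟩
    intro x y hxy
    obtain rfl : x = y := by simpa using hxy
    simp
  | cons p L ih =>
    obtain ⟨h1, hs⟩ := h.of_cons
    obtain ⟨hi, g, hg⟩ := ih h1
    obtain ⟨g', hg', -⟩ := hs.exists_flow hi hg
    refine ⟨(hs.increasingCycles_flow hi).1, g', ?_⟩
    convert hg' using 2 with z
    simp only [List.map_cons, List.count_cons, beq_iff_eq, @eq_comm _ z]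

theorem ext {L L' : List (α × α)} (h : IsClimb L) (h' : IsClimb L')
    (hp : swapProd L = swapProd L') (hf : L.map Prod.fst = L'.map Prod.fst) : L = L' := by
  induction L generalizing L' with
  | nil =>
    have : L'.map Prod.fst = [] := by rw [← hf]; rfl
    exact (List.map_eq_nil_iff.1 this).symm
  | cons p L ih =>
    cases L' with
    | nil => simp at hf
    | cons p' L' =>
      obtain ⟨i, j⟩ := p
      obtain ⟨i', j'⟩ := p'
      simp only [List.map_cons, List.cons.injEq] at hf
      obtain ⟨rfl, hf⟩ := hf
      obtain ⟨h1, hs⟩ := h.of_cons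
      obtain ⟨h1', hs'⟩ := h'.of_cons
      obtain ⟨hi, g, hg⟩ := h1.increasingCycles_flow
      obtain ⟨hi', g', hg'⟩ := h1'.increasingCycles_flow
      rw [← hp] at hs'
      rw [← hf] at hg'
      have hy := (swapProd ((i, j) :: L)).injective (hs.ry.trans hs'.ry.symm)
      rw [← hy] at hs'
      have hx := hs.fst_eq hs' hi hi' hg hg'
      have hj : j = j' := by
        have e1 := hs.rx
        have e2 := hs'.rx
        rw [hx] at e1
        exact e1.symm.trans e2
      subst hj
      rw [ih h1 h1' _ hf]
      simpa using hp

theorem exists_of_flow (l : List α) (ρ : Perm α) (hρ : IncreasingCycles ρ)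
    (hc : (exceedances ρ).card = l.length) (hf : ∃ g, IsFlow ρ (fun z => l.count z) g) :
    ∃ L, IsClimb L ∧ swapProd L = ρ ∧ L.map Prod.fst = l := by
  induction l generalizing ρ with
  | nil =>
    exact ⟨[], ⟨by simp, by simp [exceedances]⟩, (hρ.eq_one_of_exceedances hc).symm, rfl⟩
  | cons i l ih =>
    obtain ⟨g, hg⟩ := hf
    have hg' : IsFlow ρ (fun z => l.count z + if z = i then 1 else 0) g := by
      convert hg using 2 with z
      simp only [List.count_cons, beq_iff_eq, @eq_comm _ z]
    obtain ⟨σ, j, x, y, hs, hσ, hi, hf'⟩ := hg'.exists_step hρ i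
    have hcard := hs.card_exceedances
    rw [hc, List.length_cons] at hcard
    obtain ⟨L, hL, hLσ, hLl⟩ := ih σ hi (by omega) hf'
    have hprod : swapProd ((i, j) :: L) = ρ := by
      rw [swapProd_cons, hLσ, hσ, ← mul_assoc]
      simp
    refine ⟨(i, j) :: L, ⟨?_, ?_⟩, hprod, by simp [hLl]⟩
    · intro p hp
      rcases List.mem_cons.1 hp with rfl | hp
      · exact hs.lt
      · exact hL.lt p hp
    · rw [hprod, hc, ← hLl]
      simp

theorem symm_lt_of_suffix {M L : List (α × α)} (h : IsClimb L) (hM : M <:+ L) {v : α}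
    (hv : (swapProd M).symm v < v) : (swapProd L).symm v < v := by
  induction L with
  | nil => rwa [List.suffix_nil.1 hM] at hv
  | cons p L ih =>
    rcases List.suffix_cons_iff.1 hM with rfl | hM
    · exact hv
    · exact h.of_cons.2.symm_lt (ih h.of_cons.1 hM)

theorem le_of_mem_fst {L : List (α × α)} (h : IsClimb L) {v : α} (hv : v ∈ L.map Prod.fst) :
    v < swapProd L v ∧ ∀ M, M <:+ L → v ≤ swapProd M v := by
  induction L with
  | nil => simp at hv
  | cons p L ih =>
    obtain ⟨h1, hs⟩ := h.of_cons
    suffices v < swapProd (p :: L) v ∧ ∀ M, M <:+ L → v ≤ swapProd M v by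
      refine ⟨this.1, fun M hM => ?_⟩
      rcases List.suffix_cons_iff.1 hM with rfl | hM
      · exact this.1.le
      · exact this.2 M hM
    by_cases hvL : v ∈ L.map Prod.fst
    · exact ⟨hs.lt_apply (ih h1 hvL).1, (ih h1 hvL).2⟩
    · obtain rfl : v = p.1 := by
        rcases List.mem_cons.1 hv with h | h
        · exact h
        · exact absurd h hvL
      have key : ∀ M, M <:+ L → p.1 ≤ swapProd M p.1 := by
        intro M hM
        have h2 : p.1 ≤ (swapProd M).symm p.1 := by
          by_contra hc
          exact absurd (h1.symm_lt_of_suffix hM (not_le.1 hc)) (not_lt.2 hs.le_x)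
        have h3 : (swapProd M).SameCycle ((swapProd M).symm p.1) (swapProd M p.1) := by
          simpa using Perm.SameCycle.refl (swapProd M) p.1
        simpa using ((h1.of_suffix hM).increasingCycles_flow.1 _ _ h3).2 (by simpa using h2)
      refine ⟨?_, key⟩
      rcases (key L List.suffix_rfl).lt_or_eq with h2 | h2
      · exact hs.lt_apply h2
      · have : (swapProd L).symm p.1 = p.1 := by rw [symm_apply_eq]; exact h2
        have h4 := hs.rx
        rw [this] at h4
        rw [h4]
        exact hs.lt

end IsClimb

omit [Fintype α] in
theorem mem_fst_of_le {L : List (α × α)} (hL : ∀ p ∈ L, p.1 < p.2) {v : α}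
    (h : ∀ M, M <:+ L → v ≤ swapProd M v) (hv : swapProd L v ≠ v) : v ∈ L.map Prod.fst := by
  induction L with
  | nil => simp at hv
  | cons p L ih =>
    by_cases h1 : swapProd L v = v
    · have h2 := h (p :: L) List.suffix_rfl
      have h3 := hL p (by simp)
      rw [swapProd_cons, Perm.mul_apply, h1] at hv h2
      by_cases h4 : v = p.1
      · simp [h4]
      by_cases h5 : v = p.2
      · rw [h5, swap_apply_right] at h2
        exact absurd h3 (not_lt.2 h2)
      · exact absurd (swap_apply_of_ne_of_ne h4 h5) hv
    · have := ih (fun q hq => hL q (by simp [hq])) (fun M hM => h M (hM.trans (List.suffix_cons _ _))) h1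
      simp only [List.map_cons, List.mem_cons, this, or_true]

end Climb

section Parking
variable (ι : Type*) [Fintype ι] [DecidableEq ι]

/-- Parking functions, with parking spots numbered from `0`. -/
def parking : Finset (ι → ℕ) :=
  (Fintype.piFinset fun _ => Finset.range (Fintype.card ι + 1)).filter fun a =>
    ∀ z < Fintype.card ι, z + 1 ≤ (Finset.univ.filter fun k => a k ≤ z).card

/-- Parking functions that do not take the value `v`. -/
def parkingAvoiding (v : ℕ) : Finset (ι → ℕ) := (parking ι).filter fun a => ∀ k, a k ≠ v

variable {ι}

omit [DecidableEq ι] in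
theorem lt_card_of_parking {a : ι → ℕ}
    (h : ∀ z < Fintype.card ι, z + 1 ≤ (Finset.univ.filter fun k => a k ≤ z).card) (k : ι) :
    a k < Fintype.card ι := by
  have hpos : 0 < Fintype.card ι := Fintype.card_pos_iff.2 ⟨k⟩
  have h1 := h (Fintype.card ι - 1) (by omega)
  have h2 : (Finset.univ.filter fun k => a k ≤ Fintype.card ι - 1) = Finset.univ := by
    apply Finset.eq_univ_of_card
    have := Finset.card_le_univ (Finset.univ.filter fun k => a k ≤ Fintype.card ι - 1)
    omega
  have h3 : k ∈ Finset.univ.filter fun k => a k ≤ Fintype.card ι - 1 := by rw [h2]; simp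
  simp only [Finset.mem_filter, Finset.mem_univ, true_and] at h3
  omega

theorem mem_parking {a : ι → ℕ} : a ∈ parking ι ↔
    ∀ z < Fintype.card ι, z + 1 ≤ (Finset.univ.filter fun k => a k ≤ z).card := by
  rw [parking, Finset.mem_filter, and_iff_right_iff_imp]
  intro h
  rw [Fintype.mem_piFinset]
  intro k
  have := lt_card_of_parking h k
  rw [Finset.mem_range]
  omega

theorem lt_card_of_mem_parking {a : ι → ℕ} (h : a ∈ parking ι) (k : ι) :
    a k < Fintype.card ι := lt_card_of_parking (mem_parking.1 h) k

theorem mem_parkingAvoiding {a : ι → ℕ} {v : ℕ} :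
    a ∈ parkingAvoiding ι v ↔ a ∈ parking ι ∧ ∀ k, a k ≠ v := by
  rw [parkingAvoiding, Finset.mem_filter]

/-- A cyclic sequence whose sum over a period is `-1` has exactly one rotation all of whose proper
partial sums are nonnegative. -/
theorem existsUnique_rotation (n : ℕ) (hn : 0 < n) (P : ℕ → ℤ) (hP : ∀ t, P (t + n) = P t - 1) :
    ∃! r, r < n ∧ ∀ l < n, P r ≤ P (r + l) := by
  apply existsUnique_of_exists_of_unique
  · obtain ⟨r, hr, hmin⟩ := Finset.exists_min_image ((Finset.range n).filter fun r =>
      ∀ t < n, P r ≤ P t) id (by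
        obtain ⟨r, hr, hmin⟩ := Finset.exists_min_image (Finset.range n) P ⟨0, by simpa using hn⟩
        exact ⟨r, by simp at *; exact ⟨hr, hmin⟩⟩)
    simp only [Finset.mem_filter, Finset.mem_range, id] at hr hmin
    refine ⟨r, hr.1, fun l hl => ?_⟩
    by_cases hrl : r + l < n
    · exact hr.2 _ hrl
    · obtain ⟨t, ht⟩ : ∃ t, r + l = t + n := ⟨r + l - n, by omega⟩
      rw [ht, hP]
      by_contra hc
      have := hr.2 t (by omega)
      have := hmin t ⟨by omega, fun u hu => by have := hr.2 u hu; omega⟩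
      omega
  · have key : ∀ r r', r < r' → r' < n → (∀ l < n, P r ≤ P (r + l)) →
        (∀ l < n, P r' ≤ P (r' + l)) → False := by
      intro r r' hlt hr' h h'
      have h1 := h (r' - r) (by omega)
      have h2 := h' (n - (r' - r)) (by omega)
      rw [show r + (r' - r) = r' by omega] at h1
      rw [show r' + (n - (r' - r)) = r + n by omega, hP] at h2
      omega
    rintro r r' ⟨hr, h⟩ ⟨hr', h'⟩
    rcases lt_trichotomy r r' with hlt | heq | hlt
    · exact (key r r' hlt hr' h h').elim
    · exact heq
    · exact (key r' r hlt hr h' h).elim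

open Finset in
theorem existsUnique_parking_rotation (a : ι → ZMod (Fintype.card ι + 1)) :
    ∃! r : ZMod (Fintype.card ι + 1), (fun k => (a k - r).val) ∈ parking ι := by
  let cnt : ℕ → ℕ := fun t => #{k | a k = (t : ZMod (Fintype.card ι + 1))}
  let P : ℕ → ℤ := fun t => ∑ u ∈ range t, ((cnt u : ℤ) - 1)
  have hcnt : ∀ (r z : ℕ), z < Fintype.card ι + 1 →
      #{k | (a k - (r : ZMod (Fintype.card ι + 1))).val ≤ z} = ∑ u ∈ range (z + 1), cnt (r + u) := by
    intro r z hz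
    rw [← card_biUnion]
    · congr 1
      ext k
      simp only [mem_filter, mem_univ, true_and, mem_biUnion, mem_range]
      constructor
      · intro h
        refine ⟨_, Nat.lt_succ_of_le h, ?_⟩
        push_cast
        rw [ZMod.natCast_zmod_val]
        ring
      · rintro ⟨u, hu, h⟩
        rw [h]
        push_cast
        rw [add_sub_cancel_left, ZMod.val_natCast, Nat.mod_eq_of_lt (by omega)]
        omega
    · intro u hu w hw huw
      rw [Function.onFun, disjoint_left]
      intro k hk hk'
      simp only [mem_filter, mem_univ, true_and] at hk hk'
      rw [hk] at hk'
      push_cast at hk'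
      have h2 := add_left_cancel hk'
      rw [ZMod.natCast_eq_natCast_iff'] at h2
      simp only [coe_range, Set.mem_Iio] at hu hw
      rw [Nat.mod_eq_of_lt (by omega), Nat.mod_eq_of_lt (by omega)] at h2
      exact huw h2
  have hdiff : ∀ r l, P (r + l) = P r + ∑ u ∈ range l, (cnt (r + u) : ℤ) - l := by
    intro r l
    simp only [P]
    rw [sum_range_add, sum_sub_distrib _ _ (s := range l)]
    simp
    ring
  have hall : ∀ r, ∑ u ∈ range (Fintype.card ι + 1), cnt (r + u) = Fintype.card ι := by
    intro r
    rw [← hcnt r (Fintype.card ι) (by omega), filter_true_of_mem, card_univ]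
    intro k _
    exact Nat.lt_succ_iff.1 (ZMod.val_lt _)
  have hP : ∀ t, P (t + (Fintype.card ι + 1)) = P t - 1 := by
    intro t
    rw [hdiff, ← Nat.cast_sum, hall]
    push_cast
    ring
  have hiff : ∀ r : ℕ, (∀ l < Fintype.card ι + 1, P r ≤ P (r + l)) ↔
      (fun k => (a k - (r : ZMod (Fintype.card ι + 1))).val) ∈ parking ι := by
    intro r
    rw [mem_parking]
    constructor
    · intro h z hz
      rw [hcnt r z (by omega)]
      have := h (z + 1) (by omega)
      rw [hdiff] at this
      push_cast at this
      zify
      omega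
    · intro h l hl
      rw [hdiff]
      rcases l with _ | z
      · simp
      · have := h z (by omega)
        rw [hcnt r z (by omega)] at this
        zify at this
        push_cast
        omega
  obtain ⟨r, ⟨hr, h⟩, huniq⟩ := existsUnique_rotation (Fintype.card ι + 1) (by omega) P hP
  refine ⟨(r : ZMod (Fintype.card ι + 1)), (hiff r).1 h, fun s hs => ?_⟩
  have hs' : (fun k => (a k - ((s.val : ℕ) : ZMod (Fintype.card ι + 1))).val) ∈ parking ι := by
    simpa using hs
  rw [← huniq s.val ⟨ZMod.val_lt _, (hiff _).2 hs'⟩]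
  simp

open Finset in
theorem sum_eq_card_mul_sum_parking (W : (ι → ZMod (Fintype.card ι + 1)) → ℕ)
    (hW : ∀ a r, W (fun k => a k - r) = W a) :
    ∑ a, W a = (Fintype.card ι + 1) *
      ∑ a with (fun k => (a k).val) ∈ parking ι, W a := by
  classical
  have h1 : ∀ a, W a = ∑ r : ZMod (Fintype.card ι + 1),
      if (fun k => (a k - r).val) ∈ parking ι then W a else 0 := by
    intro a
    obtain ⟨r, hr, hu⟩ := existsUnique_parking_rotation a
    rw [sum_eq_single r]
    · rw [if_pos hr]
    · intro s _ hs
      rw [if_neg (fun h => hs (hu s h))]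
    · simp
  rw [sum_congr rfl fun a _ => h1 a, sum_comm]
  have h2 : ∀ r : ZMod (Fintype.card ι + 1),
      (∑ a : ι → ZMod (Fintype.card ι + 1),
        if (fun k => (a k - r).val) ∈ parking ι then W a else 0) =
      ∑ a with (fun k => (a k).val) ∈ parking ι, W a := by
    intro r
    rw [sum_filter]
    refine Fintype.sum_equiv (Equiv.subRight (fun _ => r)) _ _ fun a => ?_
    have : Equiv.subRight (fun _ => r) a = fun k => a k - r := rfl
    rw [this, hW]
  rw [sum_congr rfl fun r _ => h2 r, sum_const, card_univ, ZMod.card, smul_eq_mul]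

open Finset in
theorem sum_parking_val (W : (ι → ℕ) → ℕ) :
    ∑ a : ι → ZMod (Fintype.card ι + 1) with (fun k => (a k).val) ∈ parking ι,
      W (fun k => (a k).val) = ∑ a ∈ parking ι, W a := by
  refine sum_bij (fun a _ k => (a k).val) ?_ ?_ ?_ ?_
  · intro a ha; simpa using ha
  · intro a _ b _ h
    funext k
    exact ZMod.val_injective _ (congrFun h k)
  · intro b hb
    have : (fun k => ((b k : ℕ) : ZMod (Fintype.card ι + 1)).val) = b := by
      funext k
      rw [ZMod.val_natCast, Nat.mod_eq_of_lt]
      have := lt_card_of_mem_parking hb k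
      omega
    exact ⟨fun k => (b k : ZMod _), by rw [mem_filter, this]; exact ⟨mem_univ _, hb⟩, this⟩
  · intros; rfl

theorem card_mul_card_parking :
    (Fintype.card ι + 1) * (parking ι).card = (Fintype.card ι + 1) ^ Fintype.card ι := by
  have h := sum_eq_card_mul_sum_parking (ι := ι) (fun _ => 1) (fun _ _ => rfl)
  rw [sum_parking_val fun _ => 1] at h
  simpa [ZMod.card, eq_comm] using h

open Finset in
theorem sum_card_parkingAvoiding :
    ∑ v ∈ range (Fintype.card ι + 1), (parkingAvoiding ι v).card =
      Fintype.card ι ^ Fintype.card ι := by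
  classical
  let W : (ι → ZMod (Fintype.card ι + 1)) → ℕ := fun a => #{v | ∀ k, a k ≠ v}
  have hW : ∀ a r, W (fun k => a k - r) = W a := by
    intro a r
    refine card_bij (fun v _ => v + r) ?_ ?_ ?_
    · intro v hv
      simp only [mem_filter, mem_univ, true_and] at hv ⊢
      intro k hk
      exact hv k (by rw [hk]; ring)
    · intro v _ w _ h
      exact add_right_cancel h
    · intro v hv
      simp only [mem_filter, mem_univ, true_and] at hv
      refine ⟨v - r, ?_, by ring⟩
      simp only [mem_filter, mem_univ, true_and]
      intro k hk
      exact hv k (sub_left_injective hk)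
  have h := sum_eq_card_mul_sum_parking W hW
  have hWv : ∀ a, W a = #{v ∈ range (Fintype.card ι + 1) | ∀ k, (a k).val ≠ v} := by
    intro a
    refine card_bij (fun v _ => v.val) ?_ ?_ ?_
    · intro v hv
      simp only [mem_filter, mem_univ, true_and, mem_range] at hv ⊢
      exact ⟨ZMod.val_lt v, fun k hk => hv k (ZMod.val_injective _ hk)⟩
    · intro v _ w _ h
      exact ZMod.val_injective _ h
    · intro v hv
      simp only [mem_filter, mem_range] at hv
      have hvv : ((v : ℕ) : ZMod (Fintype.card ι + 1)).val = v := by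
        rw [ZMod.val_natCast, Nat.mod_eq_of_lt hv.1]
      refine ⟨(v : ZMod _), ?_, hvv⟩
      simp only [mem_filter, mem_univ, true_and]
      intro k hk
      exact hv.2 k (by rw [hk, hvv])
  rw [(sum_congr rfl fun a _ => hWv a).trans
    (sum_parking_val fun a => #{v ∈ range (Fintype.card ι + 1) | ∀ k, a k ≠ v})] at h
  have h3 : ∑ a ∈ parking ι, #{v ∈ range (Fintype.card ι + 1) | ∀ k, a k ≠ v} =
      ∑ v ∈ range (Fintype.card ι + 1), (parkingAvoiding ι v).card := by
    simp only [card_filter, parkingAvoiding]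
    rw [sum_comm]
  have h4 : ∑ a, W a = (Fintype.card ι + 1) * Fintype.card ι ^ Fintype.card ι := by
    simp only [W, card_filter]
    rw [sum_comm]
    have : ∀ v : ZMod (Fintype.card ι + 1),
        (∑ a : ι → ZMod (Fintype.card ι + 1), if ∀ k, a k ≠ v then 1 else 0) =
          Fintype.card ι ^ Fintype.card ι := by
      intro v
      rw [← card_filter]
      have : (univ.filter fun a : ι → ZMod (Fintype.card ι + 1) => ∀ k, a k ≠ v) =
          Fintype.piFinset fun _ => univ.erase v := by
        ext a; simp
      rw [this, Fintype.card_piFinset, prod_const, card_erase_of_mem (mem_univ _), card_univ,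
        card_univ, ZMod.card, Nat.add_sub_cancel]
    rw [sum_congr rfl fun v _ => this v, sum_const, card_univ, ZMod.card, smul_eq_mul]
  rw [← h3]
  rw [h4] at h
  exact (Nat.eq_of_mul_eq_mul_left (by omega) h).symm

end Parking

section ParkingAvoiding
open Finset
variable {ι : Type*} [Fintype ι] [DecidableEq ι]

theorem card_parking_eq_pow :
    (parking ι).card * (Fintype.card ι + 1) = (Fintype.card ι + 1) ^ Fintype.card ι := by
  rw [mul_comm, card_mul_card_parking]

theorem card_parking_congr {κ : Type*} [Fintype κ] [DecidableEq κ]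
    (h : Fintype.card ι = Fintype.card κ) : (parking ι).card = (parking κ).card := by
  have h1 := card_parking_eq_pow (ι := ι)
  have h2 := card_parking_eq_pow (ι := κ)
  rw [← h, ← h1] at h2
  exact (Nat.eq_of_mul_eq_mul_right (by omega) h2).symm

omit [DecidableEq ι] in
theorem card_filter_subtype_univ (p q : ι → Prop) [Fintype {k // p k}] [DecidablePred p] [DecidablePred q] :
    #{k : {k // p k} | q k} = #{k | p k ∧ q k} := by
  rw [← card_map (Function.Embedding.subtype p)]
  congr 1
  ext k
  simp [and_comm]

omit [DecidableEq ι] in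
theorem filter_swap_le {a : ι → ℕ} {v z : ℕ} (hz : z ≠ v) :
    (univ.filter fun k => Equiv.swap v (v + 1) (a k) ≤ z) = univ.filter fun k => a k ≤ z := by
  ext k
  simp only [mem_filter, mem_univ, true_and]
  rw [Equiv.swap_apply_def]
  split_ifs <;> omega

omit [DecidableEq ι] in
theorem filter_le_subset_filter_swap_le {a : ι → ℕ} {v : ℕ} (ha : ∀ k, a k ≠ v) (z : ℕ) :
    (univ.filter fun k => a k ≤ z) ⊆ univ.filter fun k => Equiv.swap v (v + 1) (a k) ≤ z := by
  intro k
  have := ha k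
  simp only [mem_filter, mem_univ, true_and]
  rw [Equiv.swap_apply_def]
  split_ifs <;> omega

theorem swap_comp_mem_parkingAvoiding {a : ι → ℕ} {v : ℕ} (ha : a ∈ parkingAvoiding ι v) :
    (fun k => Equiv.swap v (v + 1) (a k)) ∈ parkingAvoiding ι (v + 1) := by
  rw [mem_parkingAvoiding, mem_parking] at ha ⊢
  refine ⟨fun z hz => (ha.1 z hz).trans
    (card_le_card (filter_le_subset_filter_swap_le ha.2 z)), fun k hk => ?_⟩
  have := ha.2 k
  simp only [Equiv.swap_apply_def] at hk
  split_ifs at hk <;> omega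

omit [Fintype ι] [DecidableEq ι] in
theorem injective_swap_comp (v : ℕ) :
    Function.Injective fun (a : ι → ℕ) k => Equiv.swap v (v + 1) (a k) := by
  intro a b h
  funext k
  exact (Equiv.swap v (v + 1)).injective (congrFun h k)

theorem card_parkingAvoiding_le_succ (v : ℕ) :
    #(parkingAvoiding ι v) ≤ #(parkingAvoiding ι (v + 1)) :=
  card_le_card_of_injOn _ (fun _ ha => swap_comp_mem_parkingAvoiding ha)
    (injective_swap_comp v).injOn

variable (ι) in
/-- Parking functions that restrict to a parking function on the first `v` spots. -/
def splitParking (v : ℕ) : Finset (ι → ℕ) := (parking ι).filter fun a => #{k | a k < v} = v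

theorem mem_splitParking {a : ι → ℕ} {v : ℕ} (hv : v < Fintype.card ι)
    (ha : a ∈ parkingAvoiding ι (v + 1))
    (ha' : (fun k => Equiv.swap v (v + 1) (a k)) ∉ parkingAvoiding ι v) :
    a ∈ splitParking ι v := by
  rw [mem_parkingAvoiding] at ha ha'
  rw [splitParking, mem_filter]
  refine ⟨ha.1, le_antisymm ?_ ?_⟩
  · by_contra hc
    refine ha' ⟨mem_parking.2 fun z hz => ?_, fun k hk => ?_⟩
    · by_cases hzv : z = v
      · subst hzv
        refine le_trans (not_le.1 hc) (card_le_card fun k => ?_)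
        simp only [mem_filter, mem_univ, true_and]
        rw [Equiv.swap_apply_def]
        split_ifs <;> omega
      · rw [filter_swap_le hzv]
        exact mem_parking.1 ha.1 z hz
    · have := ha.2 k
      simp only [Equiv.swap_apply_def] at hk
      split_ifs at hk <;> omega
  · rcases v with _ | v
    · omega
    · simpa only [Nat.lt_succ_iff] using mem_parking.1 ha.1 v (by omega)

theorem card_splitParking_le {v : ℕ} (hv : v ≤ Fintype.card ι) :
    #(splitParking ι v) ≤ (Fintype.card ι).choose v *
      (#(parking (Fin v)) * #(parking (Fin (Fintype.card ι - v)))) := by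
  rw [card_eq_sum_card_fiberwise (s := splitParking ι v)
    (f := fun a : ι → ℕ => univ.filter fun k => a k < v)
    (t := powersetCard v univ)
    (fun a ha => mem_powersetCard.2 ⟨subset_univ _, (mem_filter.1 ha).2⟩)]
  refine (sum_le_card_nsmul _ _ (#(parking (Fin v)) * #(parking (Fin (Fintype.card ι - v))))
    fun S hS => ?_).trans ?_
  · rw [mem_powersetCard] at hS
    have hc1 : Fintype.card {k // k ∈ S} = v := by simp [hS.2]
    have hc2 : Fintype.card {k // k ∉ S} = Fintype.card ι - v := by
      rw [Fintype.card_subtype_compl]; simp [hS.2]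
    rw [card_parking_congr (ι := Fin v) (κ := {k // k ∈ S}) (by simp [hS.2]),
      card_parking_congr (ι := Fin (Fintype.card ι - v)) (κ := {k // k ∉ S})
        (by rw [hc2, Fintype.card_fin]), ← card_product]
    refine card_le_card_of_injOn
      (fun a => (fun k : {k // k ∈ S} => a k, fun k : {k // k ∉ S} => a k - v)) ?_ ?_
    · intro a ha
      simp only [coe_filter, Set.mem_ofPred_eq, splitParking, mem_filter] at ha
      obtain ⟨⟨hp, -⟩, hS'⟩ := ha
      have hmem : ∀ k, k ∈ S ↔ a k < v := fun k => by simp [← hS']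
      rw [mem_parking] at hp
      rw [coe_product, Set.mem_prod, mem_coe, mem_coe, mem_parking, mem_parking]
      constructor
      · intro z hz
        rw [hc1] at hz
        refine ((hp z (by omega)).trans (card_le_card fun k => ?_)).trans_eq
          (card_filter_subtype_univ (fun k => k ∈ S) (fun k => a k ≤ z)).symm
        simp only [mem_filter, mem_univ, true_and, hmem]
        omega
      · intro z hz
        rw [hc2] at hz
        have h1 := hp (z + v) (by omega)
        have h2 : (univ.filter fun k => a k ≤ z + v) ⊆
            S ∪ univ.filter fun k => k ∉ S ∧ a k - v ≤ z := by
          intro k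
          simp only [mem_union, mem_filter, mem_univ, true_and]
          intro h
          by_cases hk : k ∈ S
          · exact Or.inl hk
          · exact Or.inr ⟨hk, by omega⟩
        have h3 := (card_le_card h2).trans (card_union_le _ _)
        have h4 := card_filter_subtype_univ (fun k => k ∉ S) (fun k => a k - v ≤ z)
        rw [hS.2] at h3
        change z + 1 ≤ #{k : {k // k ∉ S} | a k - v ≤ z}
        omega
    · intro a ha b hb hab
      simp only [coe_filter, Set.mem_ofPred_eq] at ha hb
      have hmem : ∀ k, k ∈ S ↔ a k < v := fun k => by simp [← ha.2]
      have hmem' : ∀ k, k ∈ S ↔ b k < v := fun k => by simp [← hb.2]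
      rw [Prod.mk.injEq] at hab
      funext k
      by_cases hk : k ∈ S
      · exact congrFun hab.1 ⟨k, hk⟩
      · have h1 : a k - v = b k - v := congrFun hab.2 ⟨k, hk⟩
        have h2 := mt (hmem k).2 hk
        have h3 := mt (hmem' k).2 hk
        omega
  · rw [card_powersetCard, card_univ, smul_eq_mul]

theorem card_parkingAvoiding_succ_le {v : ℕ} (hv : v < Fintype.card ι) :
    #(parkingAvoiding ι (v + 1)) ≤ #(parkingAvoiding ι v) + (Fintype.card ι).choose v *
      (#(parking (Fin v)) * #(parking (Fin (Fintype.card ι - v)))) := by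
  classical
  refine le_trans ?_ (Nat.add_le_add_left (card_splitParking_le hv.le) _)
  rw [← card_image_of_injective (parkingAvoiding ι v) (injective_swap_comp v)]
  refine le_trans (card_le_card fun a ha => ?_) (card_union_le _ _)
  rw [mem_union, mem_image, or_iff_not_imp_right]
  intro h
  refine ⟨fun k => Equiv.swap v (v + 1) (a k), ?_, by simp⟩
  by_contra hc
  exact h (mem_splitParking hv ha hc)

end ParkingAvoiding

section Rotate
open Equiv
variable {m : ℕ}

theorem val_finRotate (x : Fin (m + 2)) :
    (finRotate (m + 2) x).val = if x.val = m + 1 then 0 else x.val + 1 := by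
  rw [coe_finRotate]
  simp [Fin.ext_iff]

theorem increasingCycles_finRotate : IncreasingCycles (finRotate (m + 2)) := by
  intro x y _
  simp only [Fin.lt_def, Fin.le_def, val_finRotate]
  have := x.isLt
  have := y.isLt
  split_ifs <;> omega

theorem card_exceedances_finRotate : (exceedances (finRotate (m + 2))).card = m + 1 := by
  have : exceedances (finRotate (m + 2)) = Finset.univ.erase (Fin.last (m + 1)) := by
    ext x
    rw [mem_exceedances, Finset.mem_erase, Fin.lt_def, val_finRotate, Ne, Fin.ext_iff]
    simp only [Fin.val_last, Finset.mem_univ, and_true]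
    have := x.isLt
    split_ifs <;> omega
  rw [this, Finset.card_erase_of_mem (Finset.mem_univ _)]
  simp

theorem countP_ofFn_eq_card {β : Type*} (p : β → Prop) [DecidablePred p] {N : ℕ}
    (a : Fin N → β) :
    (List.ofFn a).countP (fun x => decide (p x)) = (Finset.univ.filter fun k => p (a k)).card := by
  induction N with
  | zero => simp
  | succ N ih =>
    rw [List.ofFn_succ, List.countP_cons, ih, Finset.card_filter, Finset.card_filter,
      Fin.sum_univ_succ, add_comm]
    simp

theorem countP_val_le_succ (l : List (Fin (m + 2))) (z : Fin (m + 2)) (hz : z.val < m + 1) :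
    l.countP (fun x => decide (x.val ≤ z.val + 1)) =
      l.countP (fun x => decide (x.val ≤ z.val)) + l.count (finRotate (m + 2) z) := by
  induction l with
  | nil => simp
  | cons x l ih =>
    rw [List.countP_cons, List.countP_cons, List.count_cons, ih]
    have : (x == finRotate (m + 2) z) = decide (x.val = z.val + 1) := by
      rw [Bool.eq_iff_iff]
      simp only [beq_iff_eq, decide_eq_true_eq, Fin.ext_iff, val_finRotate]
      split_ifs <;> omega
    simp only [this, decide_eq_true_eq]
    split_ifs <;> omega

theorem countP_val_le_zero (l : List (Fin (m + 2))) :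
    l.countP (fun x => decide (x.val ≤ 0)) = l.count 0 := by
  rw [List.count]
  congr 1
  funext x
  rw [Bool.eq_iff_iff]
  simp only [decide_eq_true_eq, beq_iff_eq, Fin.ext_iff, Fin.val_zero]
  omega

theorem exists_isFlow_finRotate_iff (l : List (Fin (m + 2))) (hl : l.length = m + 1) :
    (∃ g, IsFlow (finRotate (m + 2)) (fun z => l.count z) g) ↔
      ∀ z < m + 1, z + 1 ≤ l.countP (fun x => decide (x.val ≤ z)) := by
  set C : ℕ → ℕ := fun z => l.countP (fun x => decide (x.val ≤ z)) with hC
  have hlt : ∀ z : Fin (m + 2), z < finRotate (m + 2) z ↔ z.val < m + 1 := by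
    intro z
    rw [Fin.lt_def, val_finRotate]
    have := z.isLt
    split_ifs <;> omega
  have hlast : finRotate (m + 2) (Fin.last (m + 1)) = 0 := by simp
  have h0 : C 0 = l.count 0 := countP_val_le_zero l
  have hS : ∀ z : Fin (m + 2), z.val < m + 1 →
      C (z.val + 1) = C z.val + l.count (finRotate (m + 2) z) := countP_val_le_succ l
  have hCtop : C (m + 1) = m + 1 := by
    rw [hC, ← hl]
    apply List.countP_eq_length.2
    intro x _
    have := x.isLt
    simp only [decide_eq_true_eq]
    omega
  constructor
  · rintro ⟨g, hb, hv⟩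
    have key : ∀ z (hz : z < m + 1), C z = g ⟨z, by omega⟩ + (z + 1) := by
      intro z
      induction z with
      | zero =>
        intro _
        have h1 := hb (Fin.last (m + 1))
        rw [hv (Fin.last (m + 1)) (by rw [hlast]; exact Fin.zero_le _), hlast,
          if_pos ((hlt 0).2 (by simp))] at h1
        change C 0 = g 0 + 1
        omega
      | succ z ih =>
        intro hz
        have h1 := hb ⟨z, by omega⟩
        have h2 := hS ⟨z, by omega⟩ (by simp; omega)
        have h3 : finRotate (m + 2) ⟨z, by omega⟩ = ⟨z + 1, by omega⟩ := by
          rw [Fin.ext_iff, val_finRotate]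
          simp; omega
        rw [h3, if_pos ((hlt _).2 hz)] at h1
        rw [h3] at h2
        have := ih (by omega)
        simp only at h2
        omega
    intro z hz
    have := key z hz
    change z + 1 ≤ C z
    omega
  · intro h
    refine ⟨fun z => C z.val - (z.val + 1), ⟨fun z => ?_, fun z hz => ?_⟩⟩
    · by_cases hz : z.val < m + 1
      · have h1 := hS z hz
        have h2 : C z.val ≥ z.val + 1 := h z.val hz
        have h3 := val_finRotate z
        rw [if_neg (by omega)] at h3
        simp only [hlt, h3]
        by_cases hz' : z.val + 1 < m + 1
        · have h4 : C (z.val + 1) ≥ z.val + 1 + 1 := h _ hz'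
          rw [if_pos hz']
          omega
        · rw [if_neg hz']
          have h5 : z.val = m := by omega
          rw [h5] at h1 h2 ⊢
          omega
      · have h5 : z = Fin.last (m + 1) := by
          ext; rw [Fin.val_last]; omega
        subst h5
        simp only [hlt, hlast, Fin.val_last, Fin.val_zero]
        have h2 : C 0 ≥ 0 + 1 := h 0 (by omega)
        rw [if_pos (by omega)]
        omega
    · have : z = Fin.last (m + 1) := by
        ext
        rw [Fin.val_last]
        have := mt (hlt z).2 (not_lt.2 hz)
        omega
      subst this
      simp only [Fin.val_last]
      omega

/-- Factorizations of the cycle into swaps of increasing pairs, the first of which is applied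
first. -/
def pairFactorizations (m : ℕ) : Set (Fin (m + 1) → Fin (m + 2) × Fin (m + 2)) :=
  {P | (∀ k, (P k).1 < (P k).2) ∧ swapProd (List.ofFn P).reverse = finRotate (m + 2)}

theorem isClimb_of_mem {P : Fin (m + 1) → Fin (m + 2) × Fin (m + 2)}
    (hP : P ∈ pairFactorizations m) : IsClimb (List.ofFn P).reverse := by
  refine ⟨fun p hp => ?_, ?_⟩
  · rw [List.mem_reverse, List.mem_ofFn] at hp
    obtain ⟨k, rfl⟩ := hp
    exact hP.1 k
  · rw [hP.2, card_exceedances_finRotate]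
    simp

theorem map_fst_reverse_ofFn {β γ : Type*} {N : ℕ} (P : Fin N → β × γ) :
    (List.ofFn P).reverse.map Prod.fst = (List.ofFn fun k => (P k).1).reverse := by
  rw [List.map_reverse, List.map_ofFn]
  rfl

theorem countP_reverse_ofFn (a : Fin (m + 1) → Fin (m + 2)) (z : ℕ) :
    (List.ofFn a).reverse.countP (fun x => decide (x.val ≤ z)) =
      (Finset.univ.filter fun k => (a k).val ≤ z).card := by
  rw [List.countP_reverse, countP_ofFn_eq_card (fun x : Fin (m + 2) => x.val ≤ z)]

theorem exists_pair_iff_mem_parking (a : Fin (m + 1) → Fin (m + 2)) :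
    (∃ P ∈ pairFactorizations m, (fun k => (P k).1) = a) ↔
      (fun k => (a k).val) ∈ parking (Fin (m + 1)) := by
  have h1 : (fun k => (a k).val) ∈ parking (Fin (m + 1)) ↔
      ∃ g, IsFlow (finRotate (m + 2)) (fun z => (List.ofFn a).reverse.count z) g := by
    rw [exists_isFlow_finRotate_iff _ (by simp), mem_parking, Fintype.card_fin]
    simp only [countP_reverse_ofFn]
  rw [h1]
  constructor
  · rintro ⟨P, hP, rfl⟩
    have := (isClimb_of_mem hP).increasingCycles_flow.2
    rwa [hP.2, map_fst_reverse_ofFn] at this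
  · intro h
    obtain ⟨L, hL, hLρ, hLa⟩ := IsClimb.exists_of_flow _ _ increasingCycles_finRotate
      (by rw [card_exceedances_finRotate]; simp) h
    have hlen : L.length = m + 1 := by
      rw [← List.length_map Prod.fst, hLa]; simp
    obtain ⟨P, hP⟩ : ∃ P : Fin (m + 1) → Fin (m + 2) × Fin (m + 2), List.ofFn P = L.reverse := by
      refine ⟨fun k => L.reverse.get (k.cast (by simp [hlen])), ?_⟩
      apply List.ext_get
      · simp [hlen]
      · intro n h1 h2
        simp only [List.get_ofFn]
        rfl
    have hP' : (List.ofFn P).reverse = L := by rw [hP, List.reverse_reverse]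
    refine ⟨P, ⟨fun k => ?_, by rw [hP', hLρ]⟩, ?_⟩
    · apply hL.lt
      rw [← hP', List.mem_reverse, List.mem_ofFn]
      exact ⟨k, rfl⟩
    · rw [← hP', map_fst_reverse_ofFn] at hLa
      exact List.ofFn_injective (List.reverse_injective hLa)

theorem pair_ext {P P' : Fin (m + 1) → Fin (m + 2) × Fin (m + 2)} (hP : P ∈ pairFactorizations m)
    (hP' : P' ∈ pairFactorizations m) (h : ∀ k, (P k).1 = (P' k).1) : P = P' := by
  have := (isClimb_of_mem hP).ext (isClimb_of_mem hP') (by rw [hP.2, hP'.2])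
    (by rw [map_fst_reverse_ofFn, map_fst_reverse_ofFn]; simp only [h])
  exact List.ofFn_injective (List.reverse_injective this)

theorem forall_take_iff_mem_range {P : Fin (m + 1) → Fin (m + 2) × Fin (m + 2)}
    (hP : P ∈ pairFactorizations m) (v : Fin (m + 2)) :
    (∀ k, 1 ≤ k → k ≤ m + 1 → v ≤ swapProd ((List.ofFn P).take k).reverse v) ↔
      ∃ k, (P k).1 = v := by
  have hC := isClimb_of_mem hP
  have hmem : v ∈ (List.ofFn P).reverse.map Prod.fst ↔ ∃ k, (P k).1 = v := by
    rw [map_fst_reverse_ofFn, List.mem_reverse, List.mem_ofFn]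
  rw [← hmem]
  constructor
  · intro h
    refine mem_fst_of_le hC.lt (fun M hM => ?_) ?_
    · rcases Nat.eq_zero_or_pos M.length with h0 | h0
      · rw [List.length_eq_zero_iff.1 h0]
        simp
      · have h1 := hM.length_le
        rw [List.length_reverse, List.length_ofFn] at h1
        have h2 := h M.length h0 h1
        have h3 : ((List.ofFn P).take M.length).reverse = M := by
          obtain ⟨t, ht⟩ := hM
          have : List.ofFn P = M.reverse ++ t.reverse := by
            rw [← List.reverse_append, ht, List.reverse_reverse]
          rw [this, List.take_left' (by simp), List.reverse_reverse]
        rwa [h3] at h2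
    · rw [hP.2, Ne, Fin.ext_iff, val_finRotate]
      split_ifs <;> omega
  · intro h k _ _
    refine (hC.le_of_mem_fst h).2 _ ?_
    rw [List.reverse_suffix]
    exact List.take_prefix _ _

end Rotate

section Count
open Equiv
variable {m : ℕ}

theorem swap_inj_of_lt {α : Type*} [LinearOrder α] {i j i' j' : α} (h : i < j) (h' : i' < j')
    (he : swap i j = swap i' j') : i = i' ∧ j = j' := by
  have h1 : swap i' j' i = j := by rw [← he, swap_apply_left]
  by_cases hi : i = i'
  · subst hi
    rw [swap_apply_left] at h1
    exact ⟨rfl, h1.symm⟩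
  by_cases hj : i = j'
  · subst hj
    rw [swap_apply_right] at h1
    exact absurd (h.trans (h1 ▸ h')) (lt_irrefl _)
  · rw [swap_apply_of_ne_of_ne hi hj] at h1
    exact absurd h1 h.ne

/-- The factorization into transpositions obtained by rotating a list of pairs by `-v`. -/
def rotatedSwaps (v : Fin (m + 2)) (P : Fin (m + 1) → Fin (m + 2) × Fin (m + 2)) :
    Fin (m + 1) → Perm (Fin (m + 2)) :=
  fun k => MulAut.conj (Equiv.addRight v)⁻¹ (swap (P k).1 (P k).2)

theorem prod_take_rotatedSwaps (v : Fin (m + 2)) (P : Fin (m + 1) → Fin (m + 2) × Fin (m + 2))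
    (k : ℕ) : ((List.ofFn (rotatedSwaps v P)).take k).reverse.prod =
      MulAut.conj (Equiv.addRight v)⁻¹ (swapProd ((List.ofFn P).take k).reverse) := by
  rw [swapProd, map_list_prod, List.map_map, List.map_reverse, List.map_take, List.map_ofFn]
  rfl

theorem prod_rotatedSwaps (v : Fin (m + 2)) (P : Fin (m + 1) → Fin (m + 2) × Fin (m + 2)) :
    (List.ofFn (rotatedSwaps v P)).reverse.prod =
      MulAut.conj (Equiv.addRight v)⁻¹ (swapProd (List.ofFn P).reverse) := by
  have := prod_take_rotatedSwaps v P (m + 1)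
  rwa [List.take_of_length_le (by simp), List.take_of_length_le (by simp)] at this

theorem conj_addRight_finRotate (v : Fin (m + 2)) :
    MulAut.conj (Equiv.addRight v)⁻¹ (finRotate (m + 2)) = finRotate (m + 2) := by
  rw [MulAut.conj_apply, inv_inv, mul_assoc, inv_mul_eq_iff_eq_mul]
  rw [← Equiv.coe_fn_injective.eq_iff]
  funext x
  simp only [Perm.mul_apply, finRotate_apply, Equiv.coe_addRight]
  exact add_right_comm _ _ _

theorem rotatedSwaps_injOn (v : Fin (m + 2)) :
    Set.InjOn (rotatedSwaps v) (pairFactorizations m) := by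
  intro P hP P' hP' h
  funext k
  have h1 := (MulAut.conj (Equiv.addRight v)⁻¹).injective (congrFun h k)
  have h2 := swap_inj_of_lt (hP.1 k) (hP'.1 k) h1
  exact Prod.ext h2.1 h2.2

theorem exists_lt_swap_eq {α : Type*} [LinearOrder α] {σ : Perm α} (h : σ.IsSwap) :
    ∃ p : α × α, p.1 < p.2 ∧ swap p.1 p.2 = σ := by
  obtain ⟨x, y, hxy, rfl⟩ := h
  rcases lt_or_gt_of_ne hxy with h | h
  · exact ⟨(x, y), h, rfl⟩
  · exact ⟨(y, x), h, swap_comm _ _⟩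

theorem isSwap_conj {α : Type*} [DecidableEq α] {σ : Perm α} (h : σ.IsSwap) (π : Perm α) :
    (MulAut.conj π σ).IsSwap := by
  obtain ⟨x, y, hxy, rfl⟩ := h
  refine ⟨π x, π y, fun h => hxy (π.injective h), ?_⟩
  rw [MulAut.conj_apply, swap_apply_apply]

theorem isMinFact_iff (v : Fin (m + 2)) (F : Fin (m + 1) → Perm (Fin (m + 2))) :
    IsMinFact (m + 2) F ↔ ∃ P ∈ pairFactorizations m, rotatedSwaps v P = F := by
  constructor
  · rintro ⟨h1, h2⟩
    have h3 : ∀ k, ∃ p : Fin (m + 2) × Fin (m + 2), p.1 < p.2 ∧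
        swap p.1 p.2 = MulAut.conj (Equiv.addRight v) (F k) :=
      fun k => exists_lt_swap_eq (isSwap_conj (h1 k) _)
    choose P hP hPF using h3
    have h4 : rotatedSwaps v P = F := by
      funext k
      rw [rotatedSwaps, hPF, ← MulAut.mul_apply, ← map_mul, inv_mul_cancel, map_one,
        MulAut.one_apply]
    refine ⟨P, ⟨hP, ?_⟩, h4⟩
    apply (MulAut.conj (Equiv.addRight v)⁻¹).injective
    rw [conj_addRight_finRotate, ← prod_rotatedSwaps, h4]
    exact h2
  · rintro ⟨P, hP, rfl⟩
    refine ⟨fun k => isSwap_conj ⟨_, _, (hP.1 k).ne, rfl⟩ _, ?_⟩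
    have := prod_rotatedSwaps v P
    rwa [hP.2, conj_addRight_finRotate] at this

theorem val_add_one_le_iff {q : ℕ} {v : Fin (m + 2)} (hv : v.val + q = m + 2) (x : Fin (m + 2)) :
    x.val + 1 ≤ q ↔ v ≤ x + v := by
  rw [Fin.le_def, Fin.val_add]
  have := x.isLt
  have := v.isLt
  rcases lt_or_ge (x.val + v.val) (m + 2) with h | h
  · rw [Nat.mod_eq_of_lt h]
    omega
  · rw [Nat.mod_eq_sub_mod h, Nat.mod_eq_of_lt (by omega)]
    omega

theorem natCard_trajectory {q : ℕ} {v : Fin (m + 2)} (hv : v.val + q = m + 2) :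
    Nat.card {F : Fin (m + 1) → Perm (Fin (m + 2)) //
      IsMinFact (m + 2) F ∧ ∀ k, 1 ≤ k → k ≤ m + 1 →
        (((List.ofFn F).take k).reverse.prod 0).val + 1 ≤ q} +
      (parkingAvoiding (Fin (m + 1)) v.val).card = (parking (Fin (m + 1))).card := by
  set S := {P | P ∈ pairFactorizations m ∧ ∃ k, (P k).1 = v} with hS
  have h1 : {F : Fin (m + 1) → Perm (Fin (m + 2)) |
      IsMinFact (m + 2) F ∧ ∀ k, 1 ≤ k → k ≤ m + 1 →
        (((List.ofFn F).take k).reverse.prod 0).val + 1 ≤ q} = rotatedSwaps v '' S := by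
    have key : ∀ P ∈ pairFactorizations m, (∀ k, 1 ≤ k → k ≤ m + 1 →
        (((List.ofFn (rotatedSwaps v P)).take k).reverse.prod 0).val + 1 ≤ q) ↔
          ∃ k, (P k).1 = v := by
      intro P hP
      rw [← forall_take_iff_mem_range hP v]
      refine forall₃_congr fun k _ _ => ?_
      rw [prod_take_rotatedSwaps, val_add_one_le_iff hv, MulAut.conj_apply, inv_inv,
        Perm.mul_apply, Perm.mul_apply]
      simp
    ext F
    rw [Set.mem_ofPred_eq, isMinFact_iff v]
    constructor
    · rintro ⟨⟨P, hP, rfl⟩, h⟩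
      exact ⟨P, ⟨hP, (key P hP).1 h⟩, rfl⟩
    · rintro ⟨P, ⟨hP, h⟩, rfl⟩
      exact ⟨⟨P, hP, rfl⟩, (key P hP).2 h⟩
  have h2 : (((parking (Fin (m + 1))).filter fun a => ¬ ∀ k, a k ≠ v.val : Finset _) :
      Set (Fin (m + 1) → ℕ)) = (fun P k => (P k).1.val) '' S := by
    ext b
    rw [Finset.mem_coe, Finset.mem_filter]
    constructor
    · rintro ⟨hb, hk⟩
      have hlt : ∀ k, b k < m + 2 := fun k => by
        have := lt_card_of_mem_parking hb k
        rw [Fintype.card_fin] at this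
        omega
      obtain ⟨P, hP, hPb⟩ := (exists_pair_iff_mem_parking fun k => ⟨b k, hlt k⟩).2 hb
      push Not at hk
      obtain ⟨k, hk⟩ := hk
      refine ⟨P, ⟨hP, k, ?_⟩, ?_⟩
      · rw [Fin.ext_iff, ← hk]
        exact congrArg Fin.val (congrFun hPb k)
      · funext k
        exact congrArg Fin.val (congrFun hPb k)
    · rintro ⟨P, ⟨hP, k, hk⟩, rfl⟩
      refine ⟨(exists_pair_iff_mem_parking _).1 ⟨P, hP, rfl⟩, fun h => h k (congrArg Fin.val hk)⟩
  have h3 := congrArg Set.ncard h1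
  have h4 := congrArg Set.ncard h2
  rw [Set.InjOn.ncard_image ((rotatedSwaps_injOn v).mono fun _ h => h.1)] at h3
  rw [Set.InjOn.ncard_image fun P hP P' hP' h =>
    pair_ext hP.1 hP'.1 fun k => Fin.ext (congrFun h k), Set.ncard_coe_finset] at h4
  rw [← Nat.card_coe_set_eq] at h3
  have h5 := Finset.card_filter_add_card_filter_not (s := parking (Fin (m + 1)))
    (fun a => ∀ k, a k ≠ v.val)
  rw [h4, ← h3, add_comm] at h5
  rw [parkingAvoiding]
  convert h5
  exact Iff.rfl

end Count

section Oscillation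

theorem one_div_mul_sqrt_le {x : ℝ} (hx : 1 ≤ x) :
    1 / (x * √x) ≤ 4 * (1 / √x - 1 / √(x + 1)) := by
  have h1 : 0 < √x := Real.sqrt_pos.2 (by linarith)
  have h2 : 0 < √(x + 1) := Real.sqrt_pos.2 (by linarith)
  have h3 : √x * √x = x := Real.mul_self_sqrt (by linarith)
  have h4 : √(x + 1) * √(x + 1) = x + 1 := Real.mul_self_sqrt (by linarith)
  have h5 : √(x + 1) ≤ 3 / 2 * √x := by nlinarith
  have h6 : 1 / √x - 1 / √(x + 1) = 1 / (√x * (√(x + 1) * (√x + √(x + 1)))) := by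
    field_simp
    nlinarith
  have h7 : √(x + 1) * (√x + √(x + 1)) ≤ 4 * x := by nlinarith
  rw [h6, mul_comm x, mul_one_div, div_le_div_iff₀ (by positivity) (by positivity)]
  nlinarith

theorem one_div_sqrt_le {x : ℝ} (hx : 0 ≤ x) : 1 / √(x + 1) ≤ 2 * (√(x + 1) - √x) := by
  have h1 : 0 ≤ √x := Real.sqrt_nonneg x
  have h2 : 0 < √(x + 1) := Real.sqrt_pos.2 (by linarith)
  have h3 : √x * √x = x := Real.mul_self_sqrt hx
  have h4 : √(x + 1) * √(x + 1) = x + 1 := Real.mul_self_sqrt (by linarith)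
  rw [div_le_iff₀ h2]
  nlinarith [sq_nonneg (√(x + 1) - √x)]

variable {y : ℕ → ℝ} {C : ℝ} {L : ℕ}

theorem abs_sub_le_of_increments (hC : 0 ≤ C)
    (h : ∀ w < L, |y (w + 1) - y w| ≤ C * (1 / ((w + 1 : ℝ) * √(w + 1)))) {v : ℕ} (hv : v ≤ L) :
    |y v - y L| ≤ 4 * C * (1 / √(v + 1)) := by
  suffices H : ∀ u, v ≤ u → u ≤ L →
      |y v - y u| ≤ 4 * C * (1 / √(v + 1) - 1 / √(u + 1)) from
    (H L hv le_rfl).trans (mul_le_mul_of_nonneg_left (sub_le_self _ (by positivity)) (by positivity))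
  intro u hu
  induction u, hu using Nat.le_induction with
  | base => simp
  | succ u hu ih =>
    intro huL
    have h1 := ih (by omega)
    have h2 := h u (by omega)
    have h3 := mul_le_mul_of_nonneg_left
      (one_div_mul_sqrt_le (x := (u : ℝ) + 1) (by linarith [Nat.cast_nonneg (α := ℝ) u])) hC
    have h4 := abs_sub_le (y v) (y u) (y (u + 1))
    rw [abs_sub_comm (y u)] at h4
    push_cast
    linarith

theorem sum_abs_sub_le_of_increments (hC : 0 ≤ C)
    (h : ∀ w < L, |y (w + 1) - y w| ≤ C * (1 / ((w + 1 : ℝ) * √(w + 1)))) :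
    ∑ v ∈ Finset.range L, |y v - y L| ≤ 8 * C * √L := by
  have h1 : ∀ n ≤ L, ∑ v ∈ Finset.range n, |y v - y L| ≤ 8 * C * √n := by
    intro n
    induction n with
    | zero => simp
    | succ n ih =>
      intro hn
      rw [Finset.sum_range_succ]
      have h2 := ih (by omega)
      have h3 := abs_sub_le_of_increments hC h (v := n) (by omega)
      have h4 := mul_le_mul_of_nonneg_left (one_div_sqrt_le (Nat.cast_nonneg (α := ℝ) n))
        (show 0 ≤ 4 * C by positivity)
      push_cast
      linarith
  exact h1 L le_rfl

theorem abs_sum_sub_mul_le {x : ℕ → ℝ} {N K : ℕ} (hC : 0 ≤ C) (hK : K ≤ N)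
    (h1 : ∀ w < K, |x (w + 1) - x w| ≤ C * (1 / ((w + 1 : ℝ) * √(w + 1))))
    (h2 : ∀ w < N - K, |x (N - w) - x (N - (w + 1))| ≤ C * (1 / ((w + 1 : ℝ) * √(w + 1)))) :
    |∑ v ∈ Finset.range (N + 1), x v - (N + 1) * x K| ≤ 16 * C * √(N + 1) := by
  have h3 := sum_abs_sub_le_of_increments hC h1
  have h4 := sum_abs_sub_le_of_increments (y := fun w => x (N - w)) hC (L := N - K)
    (fun w hw => by rw [abs_sub_comm]; exact h2 w hw)
  have h5 : ∑ v ∈ Finset.range (N + 1), x v - (N + 1) * x K =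
      ∑ v ∈ Finset.range (N + 1), (x v - x K) := by
    simp [Finset.sum_sub_distrib]
  have h6 : ∑ v ∈ Finset.range (N + 1), |x v - x K| =
      ∑ v ∈ Finset.range K, |x v - x K| + ∑ w ∈ Finset.range (N - K), |x (N - w) - x K| := by
    obtain ⟨M, rfl⟩ := Nat.exists_eq_add_of_le hK
    rw [add_assoc, Finset.sum_range_add, Finset.sum_range_succ' _ M, add_tsub_cancel_left]
    rw [← Finset.sum_range_reflect _ M]
    simp only [add_zero, sub_self, abs_zero]
    congr 1
    refine Finset.sum_congr rfl fun w hw => ?_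
    rw [Finset.mem_range] at hw
    congr 3
    omega
  have hle : ∀ k ≤ N, √(k : ℝ) ≤ √(N + 1) := fun k hk =>
    Real.sqrt_le_sqrt (by exact_mod_cast Nat.le_succ_of_le hk)
  rw [h5]
  refine (Finset.abs_sum_le_sum_abs _ _).trans ?_
  rw [h6]
  simp only [Nat.sub_sub_self hK] at h4
  have h7 := mul_le_mul_of_nonneg_left (hle K hK) (show 0 ≤ 8 * C by positivity)
  have h8 := mul_le_mul_of_nonneg_left (hle (N - K) (by omega)) (show 0 ≤ 8 * C by positivity)
  linarith

end Oscillation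

section Stirling

theorem card_parking_mul_stirlingSeq (k : ℕ) :
    ((parking (Fin k)).card : ℝ) * ((k + 1) * √(k + 1)) * (√2 * Stirling.stirlingSeq (k + 1)) =
      k.factorial * Real.exp 1 ^ (k + 1) := by
  have h1 : ((parking (Fin k)).card : ℝ) * (k + 1) = (k + 1) ^ k := by
    have := card_parking_eq_pow (ι := Fin k)
    rw [Fintype.card_fin] at this
    exact_mod_cast this
  have h2 : (0 : ℝ) < √2 := by positivity
  have h3 : (0 : ℝ) < √(k + 1) := by positivity
  rw [← mul_assoc (parking (Fin k)).card.cast, h1, Stirling.stirlingSeq, Nat.factorial_succ]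
  push_cast
  rw [Real.sqrt_mul (by norm_num), div_pow, pow_succ ((k : ℝ) + 1)]
  field_simp

theorem card_parking_mul_le (k : ℕ) :
    ((parking (Fin k)).card : ℝ) * ((k + 1) * √(k + 1)) ≤ k.factorial * Real.exp 1 ^ (k + 1) := by
  rw [← card_parking_mul_stirlingSeq]
  refine le_mul_of_one_le_right (by positivity) ?_
  have h1 : 1 ≤ √2 := Real.one_le_sqrt.2 (by norm_num)
  have h2 : 1 ≤ √Real.pi := Real.one_le_sqrt.2 (by linarith [Real.pi_gt_three])
  exact one_le_mul_of_one_le_of_one_le h1 (h2.trans (Stirling.sqrt_pi_le_stirlingSeq k.succ_ne_zero))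

theorem le_card_parking_mul (k : ℕ) :
    k.factorial * Real.exp 1 ^ k ≤ ((parking (Fin k)).card : ℝ) * ((k + 1) * √(k + 1)) := by
  have h1 := card_parking_mul_stirlingSeq k
  have h2 : √2 * Stirling.stirlingSeq (k + 1) ≤ Real.exp 1 := by
    have := Stirling.stirlingSeq'_antitone (Nat.zero_le k)
    simp only [Function.comp_apply, Nat.succ_eq_add_one, zero_add, Stirling.stirlingSeq_one] at this
    rwa [le_div_iff₀ (by positivity), mul_comm] at this
  rw [pow_succ, ← mul_assoc (k.factorial : ℝ)] at h1
  have h3 := mul_le_mul_of_nonneg_left h2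
    (show 0 ≤ ((parking (Fin k)).card : ℝ) * ((k + 1) * √(k + 1)) by positivity)
  rw [h1] at h3
  exact le_of_mul_le_mul_right h3 (Real.exp_pos 1)

theorem choose_mul_card_parking_le (k l : ℕ) :
    (((k + l).choose k * ((parking (Fin k)).card * (parking (Fin l)).card) : ℕ) : ℝ) *
        (((k + 1) * √(k + 1)) * ((l + 1) * √(l + 1))) ≤
      Real.exp 1 ^ 2 * (parking (Fin (k + l))).card * ((k + l + 1) * √(k + l + 1)) := by
  have h1 := mul_le_mul (card_parking_mul_le k) (card_parking_mul_le l) (by positivity)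
    (by positivity)
  have h2 := mul_le_mul_of_nonneg_left (le_card_parking_mul (k + l))
    (show 0 ≤ Real.exp 1 ^ 2 by positivity)
  have h3 : (((k + l).choose k : ℕ) : ℝ) * k.factorial * l.factorial = (k + l).factorial := by
    rw [← Nat.add_choose_mul_factorial_mul_factorial k l, Nat.choose_symm_add]
    push_cast
    rfl
  have h4 := mul_le_mul_of_nonneg_left h1 (Nat.cast_nonneg (α := ℝ) ((k + l).choose k))
  push_cast at h2 ⊢
  rw [← h3] at h2
  refine le_trans (le_of_eq ?_) (h4.trans (le_trans (le_of_eq ?_) (h2.trans (le_of_eq ?_))))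
  · ring
  · ring
  · ring

theorem mul_sqrt_le {x y : ℝ} (hy : 0 ≤ y) (h : x ≤ 2 * y) : x * √x ≤ 4 * (y * √y) := by
  have h1 : √x ≤ 2 * √y := by
    rw [Real.sqrt_le_left (by positivity), mul_pow, Real.sq_sqrt hy]
    linarith
  have := mul_le_mul h h1 (by positivity) (by positivity)
  linarith

theorem choose_mul_card_parking_le_of_le {k l : ℕ} (h : k ≤ l + 1) :
    (((k + l).choose k * ((parking (Fin k)).card * (parking (Fin l)).card) : ℕ) : ℝ) /
        (parking (Fin (k + l))).card ≤
      4 * Real.exp 1 ^ 2 * (1 / ((k + 1) * √(k + 1))) := by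
  have hpos : (0 : ℝ) < (parking (Fin (k + l))).card := by
    refine Nat.cast_pos.2 (Nat.pos_of_ne_zero fun h0 => ?_)
    have := card_parking_eq_pow (ι := Fin (k + l))
    rw [h0, zero_mul] at this
    exact absurd this.symm (by positivity)
  have h1 := choose_mul_card_parking_le k l
  have h2 : ((k : ℝ) + l + 1) * √(k + l + 1) ≤ 4 * ((l + 1) * √(l + 1)) := by
    refine mul_sqrt_le (by positivity) ?_
    have : (k : ℝ) ≤ l + 1 := by exact_mod_cast h
    linarith
  have h3 := h1.trans (mul_le_mul_of_nonneg_left h2 (by positivity))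
  have h4 : (0 : ℝ) < (l + 1) * √(l + 1) := by positivity
  rw [mul_one_div, div_le_div_iff₀ hpos (by positivity)]
  refine le_of_mul_le_mul_right (le_trans (le_of_eq ?_) (h3.trans (le_of_eq ?_))) h4 <;> ring

theorem abs_card_parkingAvoiding_sub_le {k l : ℕ} (hl : 0 < l) {x : ℝ}
    (hx : (((k + l).choose k * ((parking (Fin k)).card * (parking (Fin l)).card) : ℕ) : ℝ) /
        (parking (Fin (k + l))).card ≤ x) :
    |((parkingAvoiding (Fin (k + l)) (k + 1)).card : ℝ) / (parking (Fin (k + l))).card -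
      ((parkingAvoiding (Fin (k + l)) k).card : ℝ) / (parking (Fin (k + l))).card| ≤ x := by
  have h1 := card_parkingAvoiding_le_succ (ι := Fin (k + l)) k
  have h2 := card_parkingAvoiding_succ_le (ι := Fin (k + l)) (v := k) (by simpa using hl)
  rw [Fintype.card_fin, add_tsub_cancel_left] at h2
  have h1' : ((parkingAvoiding (Fin (k + l)) k).card : ℝ) ≤
      (parkingAvoiding (Fin (k + l)) (k + 1)).card := by exact_mod_cast h1
  have h2' := (Nat.cast_le (α := ℝ)).2 h2
  rw [Nat.cast_add] at h2'
  rw [← sub_div, abs_of_nonneg (div_nonneg (sub_nonneg.2 h1') (Nat.cast_nonneg _))]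
  exact le_trans (div_le_div_of_nonneg_right (by linarith) (Nat.cast_nonneg _)) hx

end Stirling

section Limit

theorem card_parking_fin (m : ℕ) : ((parking (Fin (m + 1))).card : ℝ) = (m + 2) ^ m := by
  have := card_parking_eq_pow (ι := Fin (m + 1))
  rw [Fintype.card_fin, pow_succ] at this
  rw [Nat.eq_of_mul_eq_mul_right (by omega) this]
  push_cast
  ring

theorem abs_card_parkingAvoiding_div_sub_le (m : ℕ) :
    |((m + 1 : ℝ) / (m + 2)) ^ (m + 1) -
      ((parkingAvoiding (Fin (m + 1)) (m + 2 - (m + 2) / 2)).card : ℝ) /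
        (parking (Fin (m + 1))).card| ≤ 64 * Real.exp 1 ^ 2 / √(m + 2) := by
  set x : ℕ → ℝ := fun v => ((parkingAvoiding (Fin (m + 1)) v).card : ℝ) /
    (parking (Fin (m + 1))).card with hx
  set K := m + 2 - (m + 2) / 2 with hK
  have hT := card_parking_fin m
  have hsum : ∑ v ∈ Finset.range (m + 1 + 1), x v =
      (m + 2) * ((m + 1 : ℝ) / (m + 2)) ^ (m + 1) := by
    have := sum_card_parkingAvoiding (ι := Fin (m + 1))
    rw [Fintype.card_fin] at this
    rw [hx, ← Finset.sum_div, ← Nat.cast_sum, this, hT, div_pow, pow_succ ((m : ℝ) + 2)]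
    push_cast
    field_simp
  have h := abs_sum_sub_mul_le (x := x) (N := m + 1) (K := K) (C := 4 * Real.exp 1 ^ 2)
    (by positivity) (by omega) ?_ ?_
  · rw [hsum] at h
    push_cast at h
    rw [add_assoc, one_add_one_eq_two, ← mul_sub, abs_mul, abs_of_pos (by positivity)] at h
    rw [le_div_iff₀ (by positivity)]
    refine le_of_mul_le_mul_right ?_ (show 0 < √((m : ℝ) + 2) by positivity)
    rw [mul_assoc, Real.mul_self_sqrt (by positivity), mul_comm]
    linarith
  · intro w hw
    obtain ⟨l, hl⟩ := Nat.exists_eq_add_of_le (show w ≤ m + 1 by omega)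
    rw [hx, hl]
    exact abs_card_parkingAvoiding_sub_le (by omega) (choose_mul_card_parking_le_of_le (by omega))
  · intro w hw
    obtain ⟨k, hk⟩ := Nat.exists_eq_add_of_le' (show w + 1 ≤ m + 1 by omega)
    have h1 : m + 1 - w = k + 1 := by omega
    have h2 : m + 1 - (w + 1) = k := by omega
    rw [h1, h2, hx, hk]
    refine abs_card_parkingAvoiding_sub_le (by omega) ?_
    have h3 := choose_mul_card_parking_le_of_le (k := w + 1) (l := k) (by omega)
    rw [add_comm (w + 1) k, ← Nat.choose_symm_add, mul_comm (parking (Fin (w + 1))).card] at h3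
    refine h3.trans (mul_le_mul_of_nonneg_left ?_ (by positivity))
    have h4 : (w + 1 : ℝ) ≤ (w + 1 : ℕ) + 1 := by push_cast; linarith
    gcongr

theorem tendsto_card_parkingAvoiding_div :
    Filter.Tendsto (fun m : ℕ =>
      ((parkingAvoiding (Fin (m + 1)) (m + 2 - (m + 2) / 2)).card : ℝ) /
        (parking (Fin (m + 1))).card) Filter.atTop (nhds (Real.exp (-1))) := by
  have h1 : Filter.Tendsto (fun m : ℕ => ((m + 1 : ℝ) / (m + 2)) ^ (m + 1)) Filter.atTop
      (nhds (Real.exp (-1))) := by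
    have := ((Real.tendsto_one_add_div_pow_exp 1).comp (Filter.tendsto_add_atTop_nat 1)).inv₀
      (Real.exp_ne_zero 1)
    rw [← Real.exp_neg] at this
    refine this.congr fun m => ?_
    simp only [Function.comp_apply]
    rw [← inv_pow]
    congr 1
    push_cast
    field_simp
    ring
  have h2 : Filter.Tendsto (fun m : ℕ => 64 * Real.exp 1 ^ 2 / √((m : ℝ) + 2)) Filter.atTop
      (nhds 0) :=
    (Real.tendsto_sqrt_atTop.comp
      (Filter.tendsto_atTop_add_const_right _ 2 tendsto_natCast_atTop_atTop)).const_div_atTop _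
  have h3 := squeeze_zero_norm
    (fun m => (Real.norm_eq_abs _).trans_le (abs_card_parkingAvoiding_div_sub_le m)) h2
  simpa using h1.sub h3

end Limit

/-- the proportion of minimal factorizations `F = (τ₁,…,τ_{n-1})` of
size `n` such that `τ₁⋯τ_k(1) ≤ ⌊n/2⌋` for every `1 ≤ k ≤ n-1` tends to `1 - e⁻¹`
as `n → ∞`. The sequence is indexed by `n = m + 2`; the element `1` of `{1,…,n}` is
the index `0 : Fin n`, an index `x : Fin n` represents the element `x + 1`, the
left-to-right partial product `τ₁⋯τ_k` is `((List.ofFn F).take k).reverse.prod`,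
and `⌊n/2⌋` is natural division `n / 2`. -/
theorem limit_trajectory_stays_low :
    Filter.Tendsto (fun m : ℕ =>
      (Nat.card {F : Fin ((m + 2) - 1) → Equiv.Perm (Fin (m + 2)) //
          IsMinFact (m + 2) F ∧ ∀ k (h1 : 1 ≤ k) (h2 : k ≤ (m + 2) - 1),
            (((List.ofFn F).take k).reverse.prod ⟨0, by omega⟩).val + 1
              ≤ (m + 2) / 2} : ℝ) /
        ((m + 2 : ℝ) ^ ((m + 2) - 2)))
      Filter.atTop (nhds (1 - Real.exp (-1))) := by
  refine (tendsto_card_parkingAvoiding_div.const_sub 1).congr fun m => ?_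
  have h1 := card_parking_fin m
  have h2 := natCard_trajectory (m := m) (q := (m + 2) / 2)
    (v := ⟨m + 2 - (m + 2) / 2, by omega⟩) (Nat.sub_add_cancel (Nat.div_le_self _ _))
  have h3 := congrArg (Nat.cast (R := ℝ)) h2
  rw [Nat.cast_add] at h3
  have h4 : (0 : ℝ) < (m + 2) ^ m := by positivity
  rw [h1] at h3 ⊢
  rw [one_sub_div h4.ne', ← eq_sub_of_add_eq h3]
  rfl
end
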